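/- Let 0 < p < ∞ and let ω be an invariant weight on the unit disc such that the polynomials are dense in A^p_ω. Let f ∈ A^p_ω and let 0 < p₁, p₂ < ∞ with 1/p = 1/p₁ + 1/p₂. Then there exist f₁ ∈ A^{p₁}_ω and f₂ ∈ A^{p₂}_ω such that f = f₁ · f₂ and ‖f₁‖_{A^{p₁}_ω}^p · ‖f₂‖_{A^{p₂}_ω}^p ≤ (p/p₁)‖f₁‖_{A^{p₁}_ω}^{p₁} + (p/p₂)‖f₂‖_{A^{p₂}_ω}^{p₂} ≤ C ‖f‖_{A^p_ω}^p for some constant C = C(p₁, p₂, ω) > 0. -/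

import Mathlib

open MeasureTheory Set Filter

noncomputable section

/-- The open unit disc in `ℂ`. -/
def unitDisc : Set ℂ := {z : ℂ | ‖z‖ < 1}

/-- A weight on the unit disc: positive and integrable on `𝔻`. -/
def IsWeight (W : ℂ → ℝ) : Prop :=
  (∀ z ∈ unitDisc, 0 < W z) ∧ IntegrableOn W unitDisc

/-- An invariant weight: `W(z) ≍ W(a)` on pseudohyperbolic discs `Δ(a,r)` of some
(equivalently, every) fixed radius `r ∈ (0,1)`. -/
def IsInvariantWeight (W : ℂ → ℝ) : Prop :=
  ∃ r : ℝ, 0 < r ∧ r < 1 ∧ ∃ C : ℝ, 1 ≤ C ∧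
    ∀ a ∈ unitDisc, ∀ z ∈ unitDisc,
      ‖(a - z) / (1 - (starRingEnd ℂ) a * z)‖ < r →
        C⁻¹ * W a ≤ W z ∧ W z ≤ C * W a

/-- The polynomials are dense in `A^p_W`. -/
def PolyDense (p : ℝ) (W : ℂ → ℝ) : Prop :=
  ∀ f : ℂ → ℂ, DifferentiableOn ℂ f unitDisc →
    IntegrableOn (fun z => ‖f z‖ ^ p * W z) unitDisc →
    ∀ ε : ℝ, 0 < ε → ∃ P : Polynomial ℂ,
      (∫ z in unitDisc, ‖f z - P.eval z‖ ^ p * W z) < ε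

/-- The disc automorphism exchanging `0` and `a`. -/
def mob (a z : ℂ) : ℂ := (a - z) / (1 - (starRingEnd ℂ) a * z)

lemma one_sub_conj_mul_ne_zero {a z : ℂ} (ha : a ∈ unitDisc) (hz : z ∈ unitDisc) :
    1 - (starRingEnd ℂ) a * z ≠ 0 := by
  intro h
  have h1 : ‖(starRingEnd ℂ) a * z‖ = 1 := by
    rw [← sub_eq_zero.mp h, norm_one]
  rw [norm_mul, RCLike.norm_conj] at h1
  have h2 : ‖a‖ < 1 := ha
  have h3 : ‖z‖ < 1 := hz
  nlinarith [norm_nonneg a, norm_nonneg z]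

lemma one_sub_sq_pos {a : ℂ} (ha : a ∈ unitDisc) : 0 < 1 - ‖a‖ ^ 2 := by
  have h2 : ‖a‖ < 1 := ha
  nlinarith [norm_nonneg a]

lemma one_sub_norm_mob_sq {a z : ℂ} (ha : a ∈ unitDisc) (hz : z ∈ unitDisc) :
    1 - ‖mob a z‖ ^ 2 =
      (1 - ‖a‖ ^ 2) * (1 - ‖z‖ ^ 2) / ‖1 - (starRingEnd ℂ) a * z‖ ^ 2 := by
  have h := one_sub_conj_mul_ne_zero ha hz
  have h' : ‖1 - (starRingEnd ℂ) a * z‖ ^ 2 ≠ 0 := by positivity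
  rw [mob, norm_div, div_pow, eq_div_iff h', sub_mul, div_mul_cancel₀ _ h', one_mul]
  simp only [Complex.sq_norm, Complex.normSq_apply, Complex.sub_re, Complex.sub_im,
    Complex.mul_re, Complex.mul_im, Complex.conj_re, Complex.conj_im, Complex.one_re,
    Complex.one_im]
  ring

lemma mob_mem {a z : ℂ} (ha : a ∈ unitDisc) (hz : z ∈ unitDisc) : mob a z ∈ unitDisc := by
  have h := one_sub_norm_mob_sq ha hz
  have h1 : 0 < 1 - ‖mob a z‖ ^ 2 := by
    rw [h]
    have := one_sub_conj_mul_ne_zero ha hz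
    have := one_sub_sq_pos ha
    have := one_sub_sq_pos hz
    positivity
  change ‖mob a z‖ < 1
  nlinarith [norm_nonneg (mob a z)]

lemma norm_one_sub_conj_mul_comm (a z : ℂ) :
    ‖1 - (starRingEnd ℂ) z * a‖ = ‖1 - (starRingEnd ℂ) a * z‖ := by
  rw [← RCLike.norm_conj]
  simp only [map_sub, map_mul, map_one, Complex.conj_conj]
  rw [mul_comm]

lemma mob_mob_mob {a z w : ℂ} (ha : a ∈ unitDisc) (hz : z ∈ unitDisc) (hw : w ∈ unitDisc) :
    ‖mob (mob a z) (mob a w)‖ = ‖mob z w‖ := by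
  have h1 := one_sub_conj_mul_ne_zero ha hz
  have h2 := one_sub_conj_mul_ne_zero ha hw
  have h3 := one_sub_conj_mul_ne_zero hz hw
  have h4 := one_sub_conj_mul_ne_zero hz ha
  have h5 := one_sub_conj_mul_ne_zero ha ha
  have e1 : mob a z - mob a w = (w - z) * (1 - (starRingEnd ℂ) a * a) /
      ((1 - (starRingEnd ℂ) a * z) * (1 - (starRingEnd ℂ) a * w)) := by
    unfold mob
    rw [div_sub_div _ _ h1 h2]
    congr 1
    ring
  have e2 : 1 - (starRingEnd ℂ) (mob a z) * mob a w =
      (1 - (starRingEnd ℂ) a * a) * (1 - (starRingEnd ℂ) z * w) /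
      ((1 - (starRingEnd ℂ) z * a) * (1 - (starRingEnd ℂ) a * w)) := by
    unfold mob
    simp only [map_div₀, map_sub, map_mul, map_one, Complex.conj_conj]
    rw [mul_comm a, div_mul_div_comm, eq_div_iff (mul_ne_zero h4 h2), sub_mul,
      div_mul_cancel₀ _ (mul_ne_zero h4 h2)]
    ring
  have e3 := norm_one_sub_conj_mul_comm a z
  have n1 := norm_ne_zero_iff.mpr h1
  have n2 := norm_ne_zero_iff.mpr h2
  have n3 := norm_ne_zero_iff.mpr h3
  have n5 := norm_ne_zero_iff.mpr h5
  rw [mob, e1, e2, mob]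
  simp only [norm_div, norm_mul, e3]
  rw [norm_sub_rev w z, div_div_div_eq, div_eq_div_iff (by positivity) (by positivity)]
  ring

lemma mob_involutive {a z : ℂ} (ha : a ∈ unitDisc) (hz : z ∈ unitDisc) :
    mob a (mob a z) = z := by
  have h1 := one_sub_conj_mul_ne_zero ha hz
  have h5 := one_sub_conj_mul_ne_zero ha ha
  have e1 : a - mob a z = z * (1 - (starRingEnd ℂ) a * a) / (1 - (starRingEnd ℂ) a * z) := by
    unfold mob
    rw [eq_div_iff h1, sub_mul, div_mul_cancel₀ _ h1]
    ring
  have e2 : 1 - (starRingEnd ℂ) a * mob a z =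
      (1 - (starRingEnd ℂ) a * a) / (1 - (starRingEnd ℂ) a * z) := by
    unfold mob
    rw [eq_div_iff h1, sub_mul, mul_assoc, div_mul_cancel₀ _ h1]
    ring
  rw [mob, e1, e2, div_div_div_cancel_right₀ h1, mul_div_cancel_right₀ _ h5]

lemma norm_mob_comm (a z : ℂ) : ‖mob a z‖ = ‖mob z a‖ := by
  rw [mob, mob, norm_div, norm_div, norm_sub_rev, norm_one_sub_conj_mul_comm]

lemma norm_mob_mob {a z w : ℂ} (ha : a ∈ unitDisc) (hz : z ∈ unitDisc) (hw : w ∈ unitDisc) :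
    ‖mob a (mob z w)‖ = ‖mob (mob z a) w‖ := by
  conv_lhs => rw [← mob_involutive hz ha]
  rw [mob_mob_mob hz (mob_mem hz ha) hw]

@[simp] lemma mob_zero (a : ℂ) : mob a 0 = a := by simp [mob]

@[simp] lemma mob_self (a : ℂ) : mob a a = 0 := by simp [mob]

lemma mob_eq_zero_iff {a z : ℂ} (ha : a ∈ unitDisc) (hz : z ∈ unitDisc) :
    mob a z = 0 ↔ z = a := by
  rw [mob, div_eq_zero_iff, or_iff_left (one_sub_conj_mul_ne_zero ha hz), sub_eq_zero, eq_comm]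

lemma hasDerivAt_mob {a z : ℂ} (ha : a ∈ unitDisc) (hz : z ∈ unitDisc) :
    HasDerivAt (mob a) (-(1 - (starRingEnd ℂ) a * a) / (1 - (starRingEnd ℂ) a * z) ^ 2) z := by
  have h1 := one_sub_conj_mul_ne_zero ha hz
  have h2 : HasDerivAt (fun z => a - z) (-1) z := by
    simpa using (hasDerivAt_id z).const_sub a
  have h3 : HasDerivAt (fun z => 1 - (starRingEnd ℂ) a * z) (-(starRingEnd ℂ) a) z := by
    simpa using ((hasDerivAt_id z).const_mul ((starRingEnd ℂ) a)).const_sub 1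
  refine (h2.div h3 h1).congr_deriv ?_
  ring

lemma measurable_mob₂ : Measurable (fun x : ℂ × ℂ => mob x.1 x.2) := by
  unfold mob
  exact (measurable_fst.sub measurable_snd).div
    (measurable_const.sub ((Complex.continuous_conj.measurable.comp measurable_fst).mul
      measurable_snd))

lemma measurable_mob (a : ℂ) : Measurable (mob a) :=
  measurable_mob₂.comp (measurable_const.prodMk measurable_id)

lemma differentiableOn_mob {a : ℂ} (ha : a ∈ unitDisc) : DifferentiableOn ℂ (mob a) unitDisc :=
  fun _ hz => (hasDerivAt_mob ha hz).differentiableAt.differentiableWithinAt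

lemma unitDisc_eq_ball : unitDisc = Metric.ball (0 : ℂ) 1 := by
  ext z; simp [unitDisc]

lemma isOpen_unitDisc : IsOpen unitDisc := unitDisc_eq_ball ▸ Metric.isOpen_ball

lemma measurableSet_unitDisc : MeasurableSet unitDisc := isOpen_unitDisc.measurableSet

lemma det_restrictScalars_toSpanSingleton (c : ℂ) :
    ((ContinuousLinearMap.toSpanSingleton ℂ c).restrictScalars ℝ).det = ‖c‖ ^ 2 := by
  change LinearMap.det ((LinearMap.toSpanSingleton ℂ ℂ c).restrictScalars ℝ) = _
  rw [LinearMap.det_restrictScalars, Algebra.norm_complex_apply, Complex.normSq_eq_norm_sq]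
  simp

lemma lintegral_comp_mob {a : ℂ} (ha : a ∈ unitDisc) (g : ℂ → ENNReal) :
    ∫⁻ w in unitDisc, g w = ∫⁻ u in unitDisc,
      ENNReal.ofReal ((1 - ‖a‖ ^ 2) ^ 2 / ‖1 - (starRingEnd ℂ) a * u‖ ^ 4) * g (mob a u) := by
  have him : mob a '' unitDisc = unitDisc := by
    ext z
    constructor
    · rintro ⟨w, hw, rfl⟩
      exact mob_mem ha hw
    · exact fun hz => ⟨mob a z, mob_mem ha hz, mob_involutive ha hz⟩
  have hinj : InjOn (mob a) unitDisc := fun z hz w hw h => by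
    rw [← mob_involutive ha hz, h, mob_involutive ha hw]
  have key := lintegral_image_eq_lintegral_abs_det_fderiv_mul volume measurableSet_unitDisc
    (fun z hz => ((hasDerivAt_mob ha hz).hasFDerivAt.restrictScalars ℝ).hasFDerivWithinAt) hinj g
  rw [him] at key
  rw [key]
  refine setLIntegral_congr_fun measurableSet_unitDisc fun u _ => ?_
  congr 2
  have h6 : ‖1 - (starRingEnd ℂ) a * a‖ = 1 - ‖a‖ ^ 2 := by
    rw [mul_comm, Complex.mul_conj, Complex.normSq_eq_norm_sq, ← Complex.ofReal_one,
      ← Complex.ofReal_sub, Complex.norm_real, Real.norm_of_nonneg (one_sub_sq_pos ha).le]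
  rw [det_restrictScalars_toSpanSingleton, norm_div, norm_neg, norm_pow, h6, abs_sq, div_pow,
    ← pow_mul]

/-- The rotation-invariant probability measure on the disc with radial distribution
`q r ^ (q - 1) dr`. -/
def radialMeasure (q : ℝ) : Measure ℂ :=
  (volume.restrict unitDisc).withDensity
    (fun w => ENNReal.ofReal (q / (2 * Real.pi) * ‖w‖ ^ (q - 2)))

lemma measurable_radialDensity (q : ℝ) :
    Measurable (fun w : ℂ => ENNReal.ofReal (q / (2 * Real.pi) * ‖w‖ ^ (q - 2))) := by
  fun_prop

lemma ae_radialMeasure_mem (q : ℝ) : ∀ᵐ w ∂radialMeasure q, w ∈ unitDisc :=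
  (withDensity_absolutelyContinuous _ _).ae_le (ae_restrict_mem measurableSet_unitDisc)

lemma ae_radialMeasure_ne (q : ℝ) (b : ℂ) : ∀ᵐ w ∂radialMeasure q, w ≠ b :=
  (withDensity_absolutelyContinuous _ _).ae_le (ae_restrict_of_ae (Measure.ae_ne volume b))

lemma lintegral_radialMeasure (q : ℝ) {g : ℂ → ENNReal} (hg : Measurable g) :
    ∫⁻ w, g w ∂radialMeasure q = ∫⁻ r in Ioo (0 : ℝ) 1,
      ENNReal.ofReal (q / (2 * Real.pi) * r ^ (q - 1)) *
        ∫⁻ θ in Ioo (-Real.pi) Real.pi, g (circleMap 0 r θ) := by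
  rw [radialMeasure, lintegral_withDensity_eq_lintegral_mul _ (measurable_radialDensity q) hg,
    ← lintegral_indicator measurableSet_unitDisc, ← Complex.lintegral_comp_polarCoord_symm,
    polarCoord_target, Measure.volume_eq_prod, ← Measure.prod_restrict]
  have hmeas : Measurable (unitDisc.indicator
      ((fun w : ℂ => ENNReal.ofReal (q / (2 * Real.pi) * ‖w‖ ^ (q - 2))) * g)) :=
    ((measurable_radialDensity q).mul hg).indicator measurableSet_unitDisc
  have hsymm : Measurable (fun p : ℝ × ℝ => Complex.polarCoord.symm p) := by
    have : (fun p : ℝ × ℝ => Complex.polarCoord.symm p) =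
        fun p : ℝ × ℝ => (p.1 : ℂ) * (Real.cos p.2 + Real.sin p.2 * Complex.I) := by
      ext p; rw [Complex.polarCoord_symm_apply]
    rw [this]
    fun_prop
  rw [lintegral_prod]
  swap
  · exact ((ENNReal.measurable_ofReal.comp measurable_fst).mul
      (hmeas.comp hsymm)).aemeasurable
  have hIoo : Ioo (0 : ℝ) 1 = Ioi 0 ∩ Iio 1 := rfl
  rw [hIoo, inter_comm, ← setLIntegral_indicator measurableSet_Iio]
  refine setLIntegral_congr_fun measurableSet_Ioi fun r hr => ?_
  have hr0 : 0 < r := hr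
  have hs : ∀ θ : ℝ, Complex.polarCoord.symm (r, θ) = circleMap 0 r θ := fun θ => by
    rw [Complex.polarCoord_symm_apply, circleMap, Complex.exp_mul_I, zero_add]
    push_cast
    ring
  have hn : ∀ θ : ℝ, ‖circleMap 0 r θ‖ = r := fun θ => by
    rw [norm_circleMap_zero, abs_of_pos hr0]
  simp only [hs]
  by_cases h1 : r < 1
  · have hmem : ∀ θ, circleMap 0 r θ ∈ unitDisc := fun θ => (hn θ).trans_lt h1
    rw [indicator_of_mem (show r ∈ Iio (1 : ℝ) from h1)]
    simp only [indicator_of_mem (hmem _), Pi.mul_apply, hn, smul_eq_mul]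
    rw [lintegral_const_mul' _ _ ENNReal.ofReal_ne_top,
      lintegral_const_mul' _ _ ENNReal.ofReal_ne_top, ← mul_assoc,
      ← ENNReal.ofReal_mul hr0.le]
    congr 2
    rw [show q - 1 = (q - 2) + 1 by ring, Real.rpow_add_one hr0.ne']
    ring
  · have hmem : ∀ θ, circleMap 0 r θ ∉ unitDisc := fun θ h => h1 ((hn θ) ▸ h)
    rw [indicator_of_notMem (show r ∉ Iio (1 : ℝ) from h1)]
    simp [indicator_of_notMem (hmem _)]

lemma lintegral_radialMeasure_of_circleAverage {q : ℝ} (hq : 0 < q) {u : ℂ → ℝ} {m : ℝ → ℝ}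
    (hu : Measurable (unitDisc.indicator u)) (hpos : ∀ w ∈ unitDisc, 0 ≤ u w)
    (hint : ∀ r ∈ Ioo (0 : ℝ) 1, CircleIntegrable u 0 r)
    (havg : ∀ r ∈ Ioo (0 : ℝ) 1, Real.circleAverage u 0 r = m r) :
    ∫⁻ w, ENNReal.ofReal (u w) ∂radialMeasure q =
      ∫⁻ r in Ioo (0 : ℝ) 1, ENNReal.ofReal (q * r ^ (q - 1) * m r) := by
  have h1 : ∫⁻ w, ENNReal.ofReal (u w) ∂radialMeasure q =
      ∫⁻ w, ENNReal.ofReal (unitDisc.indicator u w) ∂radialMeasure q := by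
    refine lintegral_congr_ae ?_
    filter_upwards [ae_radialMeasure_mem q] with w hw
    rw [indicator_of_mem hw]
  rw [h1, lintegral_radialMeasure q hu.ennreal_ofReal]
  refine setLIntegral_congr_fun measurableSet_Ioo fun r hr => ?_
  have hmem : ∀ θ, circleMap 0 r θ ∈ unitDisc := fun θ => by
    change ‖circleMap 0 r θ‖ < 1
    rw [norm_circleMap_zero, abs_of_pos hr.1]
    exact hr.2
  have hpi := Real.pi_pos
  have hper : Function.Periodic (fun θ => u (circleMap 0 r θ)) (2 * Real.pi) :=
    fun θ => by simp only [periodic_circleMap 0 r θ]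
  have hI : IntervalIntegrable (fun θ => u (circleMap 0 r θ)) volume (-Real.pi) Real.pi := by
    exact hper.intervalIntegrable₀ Real.two_pi_pos.ne' (hint r hr) _ _
  have h2 : ∫⁻ θ in Ioo (-Real.pi) Real.pi,
      ENNReal.ofReal (unitDisc.indicator u (circleMap 0 r θ)) =
      ENNReal.ofReal (2 * Real.pi * m r) := by
    simp only [indicator_of_mem (hmem _)]
    rw [← havg r hr, Real.circleAverage_def, smul_eq_mul, mul_inv_cancel_left₀ (by positivity),
      ← ofReal_integral_eq_lintegral_ofReal]
    · congr 1
      rw [← integral_Ioc_eq_integral_Ioo,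
        ← intervalIntegral.integral_of_le (by linarith)]
      have := hper.intervalIntegral_add_eq (-Real.pi) 0
      rw [zero_add, show -Real.pi + 2 * Real.pi = Real.pi by ring] at this
      exact this
    · exact (intervalIntegrable_iff_integrableOn_Ioo_of_le (by linarith)).mp hI
    · exact Eventually.of_forall fun θ => hpos _ (hmem θ)
  rw [h2, ← ENNReal.ofReal_mul (by have := hr.1; positivity)]
  congr 1
  field_simp

lemma lintegral_Ioo_of_hasDerivAt {a b : ℝ} (hab : a ≤ b) {f G : ℝ → ℝ}
    (hc : ContinuousOn G (Icc a b)) (hd : ∀ r ∈ Ioo a b, HasDerivAt G (f r) r)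
    (hpos : ∀ r ∈ Ioo a b, 0 ≤ f r) :
    ∫⁻ r in Ioo a b, ENNReal.ofReal (f r) = ENNReal.ofReal (G b - G a) := by
  have hi : IntegrableOn f (Ioc a b) := intervalIntegral.integrableOn_deriv_of_nonneg hc hd hpos
  rw [← intervalIntegral.integral_eq_sub_of_hasDerivAt_of_le hab hc hd
    ((intervalIntegrable_iff_integrableOn_Ioc_of_le hab).mpr hi),
    intervalIntegral.integral_of_le hab, integral_Ioc_eq_integral_Ioo,
    ofReal_integral_eq_lintegral_ofReal (hi.mono_set Ioo_subset_Ioc_self)]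
  exact (ae_restrict_iff' measurableSet_Ioo).mpr (Eventually.of_forall hpos)

lemma continuous_rpow_mul_log {q : ℝ} (hq : 0 < q) :
    Continuous (fun r : ℝ => q⁻¹ * (|r| ^ q * Real.log (|r| ^ q))) := by
  have h := Real.continuous_mul_log.comp
    ((Real.continuous_rpow_const hq.le).comp continuous_abs)
  exact continuous_const.mul h

lemma lintegral_radial_const {q : ℝ} (hq : 0 < q) {c : ℝ} (hc : 0 ≤ c) :
    ∫⁻ r in Ioo (0 : ℝ) 1, ENNReal.ofReal (q * r ^ (q - 1) * c) = ENNReal.ofReal c := by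
  rw [lintegral_Ioo_of_hasDerivAt (G := fun r => r ^ q * c) zero_le_one]
  · simp [Real.zero_rpow hq.ne']
  · exact ((Real.continuous_rpow_const hq.le).mul continuous_const).continuousOn
  · intro r hr
    exact (Real.hasDerivAt_rpow_const (Or.inl hr.1.ne')).mul_const c
  · intro r hr
    have := hr.1
    positivity

lemma lintegral_radial_log_max {q : ℝ} (hq : 0 < q) {x : ℝ} (hx : 0 ≤ x) (hx1 : x < 1) :
    ∫⁻ r in Ioo (0 : ℝ) 1, ENNReal.ofReal (q * r ^ (q - 1) * -Real.log (max r x)) =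
      ENNReal.ofReal ((1 - x ^ q) / q) := by
  have hlogx : Real.log x ≤ 0 := Real.log_nonpos hx hx1.le
  have hsplit : (∫⁻ r in Ioo (0 : ℝ) 1, ENNReal.ofReal (q * r ^ (q - 1) * -Real.log (max r x))) =
      (∫⁻ r in Ioo 0 x, ENNReal.ofReal (q * r ^ (q - 1) * -Real.log (max r x))) +
      ∫⁻ r in Ioo x 1, ENNReal.ofReal (q * r ^ (q - 1) * -Real.log (max r x)) := by
    rw [setLIntegral_congr (Ioo_ae_eq_Ioc (a := (0 : ℝ)) (b := 1)),
      setLIntegral_congr (Ioo_ae_eq_Ioc (a := (0 : ℝ)) (b := x)),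
      setLIntegral_congr (Ioo_ae_eq_Ioc (a := x) (b := 1)),
      ← Ioc_union_Ioc_eq_Ioc hx hx1.le,
      lintegral_union measurableSet_Ioc (Ioc_disjoint_Ioc_of_le le_rfl)]
  have h1 : (∫⁻ r in Ioo 0 x, ENNReal.ofReal (q * r ^ (q - 1) * -Real.log (max r x))) =
      ENNReal.ofReal (x ^ q * -Real.log x) := by
    rw [setLIntegral_congr_fun (g := fun r => ENNReal.ofReal (q * r ^ (q - 1) * -Real.log x))
      measurableSet_Ioo (fun r hr => by simp only [max_eq_right hr.2.le])]
    rw [lintegral_Ioo_of_hasDerivAt (G := fun r => r ^ q * -Real.log x) hx]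
    · simp [Real.zero_rpow hq.ne']
    · exact ((Real.continuous_rpow_const hq.le).mul continuous_const).continuousOn
    · intro r hr
      exact (Real.hasDerivAt_rpow_const (Or.inl hr.1.ne')).mul_const _
    · intro r hr
      have := hr.1
      have : 0 ≤ -Real.log x := by linarith
      positivity
  have h2 : (∫⁻ r in Ioo x 1, ENNReal.ofReal (q * r ^ (q - 1) * -Real.log (max r x))) =
      ENNReal.ofReal (1 / q - (x ^ q / q - x ^ q * Real.log x)) := by
    rw [setLIntegral_congr_fun (g := fun r => ENNReal.ofReal (q * r ^ (q - 1) * -Real.log r))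
      measurableSet_Ioo (fun r hr => by simp only [max_eq_left hr.1.le])]
    rw [lintegral_Ioo_of_hasDerivAt (G := fun r => r ^ q / q - r ^ q * Real.log r) hx1.le]
    · simp
    · refine (((Real.continuous_rpow_const hq.le).div_const q).sub
        (continuous_rpow_mul_log hq)).continuousOn.congr fun r hr => ?_
      have hr0 : 0 ≤ r := hx.trans hr.1
      rcases hr0.eq_or_lt with rfl | hr0
      · simp [Real.zero_rpow hq.ne']
      · change _ = r ^ q / q - q⁻¹ * (|r| ^ q * Real.log (|r| ^ q))
        rw [abs_of_pos hr0, Real.log_rpow hr0]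
        field_simp
    · intro r hr
      have hr0 : 0 < r := hx.trans_lt hr.1
      have hd := Real.hasDerivAt_rpow_const (p := q) (Or.inl hr0.ne')
      refine ((hd.div_const q).sub (hd.mul (Real.hasDerivAt_log hr0.ne'))).congr_deriv ?_
      rw [Real.rpow_sub_one hr0.ne']
      field_simp
      ring
    · intro r hr
      have hr0 : 0 < r := hx.trans_lt hr.1
      have : 0 ≤ -Real.log r := by linarith [Real.log_nonpos hr0.le hr.2.le]
      positivity
  have hxq : x ^ q ≤ 1 := Real.rpow_le_one hx hx1.le hq.le
  have hxq0 : 0 ≤ x ^ q := Real.rpow_nonneg hx q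
  rw [hsplit, h1, h2, ← ENNReal.ofReal_add]
  · congr 1
    ring
  · exact mul_nonneg hxq0 (by linarith)
  · have h3 : Real.log (x ^ q) ≤ 0 := Real.log_nonpos hxq0 hxq
    rcases hx.eq_or_lt with rfl | hx0
    · simp [Real.zero_rpow hq.ne', hq.le]
    · have h4 := Real.add_one_le_exp (-(q * Real.log x))
      rw [Real.exp_neg, ← Real.exp_log (Real.rpow_pos_of_pos hx0 q)] at *
      rw [Real.log_exp, Real.log_rpow hx0] at *
      have h5 := Real.exp_pos (q * Real.log x)
      have h6 : Real.exp (q * Real.log x) * (-(q * Real.log x) + 1) ≤ 1 := by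
        calc _ ≤ Real.exp (q * Real.log x) * (Real.exp (q * Real.log x))⁻¹ := by gcongr
          _ = 1 := mul_inv_cancel₀ h5.ne'
      have : 1 / q - (Real.exp (q * Real.log x) / q - Real.exp (q * Real.log x) * Real.log x) =
        (1 - Real.exp (q * Real.log x) * (-(q * Real.log x) + 1)) / q := by
        field_simp
        ring
      rw [this]
      exact div_nonneg (by linarith) hq.le

lemma lintegral_radial_log_one_sub_lt_top {q : ℝ} (hq : 0 < q) :
    ∫⁻ r in Ioo (0 : ℝ) 1, ENNReal.ofReal (q * r ^ (q - 1) * -Real.log (1 - r)) < ⊤ := by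
  have h := Complex.betaIntegral_convergent (u := (q : ℂ)) (v := (1 / 2 : ℝ))
    (by simpa using hq) (by norm_num)
  have h2 := ((intervalIntegrable_iff_integrableOn_Ioo_of_le zero_le_one).mp h).norm.const_mul
    (2 * q)
  refine lt_of_le_of_lt ?_ h2.lintegral_lt_top
  refine setLIntegral_mono_ae' measurableSet_Ioo (Eventually.of_forall fun r hr => ?_)
  refine ENNReal.ofReal_le_ofReal ?_
  have h0 := hr.1
  have h1 : 0 < 1 - r := by linarith [hr.2]
  have e1 : ‖(r : ℂ) ^ ((q : ℂ) - 1)‖ = r ^ (q - 1) := by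
    rw [Complex.norm_cpow_eq_rpow_re_of_pos h0]
    simp
  have e2 : ‖(1 - (r : ℂ)) ^ (((1 / 2 : ℝ) : ℂ) - 1)‖ = (1 - r) ^ (-(1 / 2) : ℝ) := by
    rw [← Complex.ofReal_one, ← Complex.ofReal_sub, Complex.norm_cpow_eq_rpow_re_of_pos h1]
    congr 1
    rw [← Complex.ofReal_sub, Complex.ofReal_re]
    norm_num
  rw [norm_mul, e1, e2]
  have h3 := Real.log_le_rpow_div (x := (1 - r)⁻¹) (inv_nonneg.mpr h1.le)
    (ε := 1 / 2) (by norm_num)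
  rw [Real.log_inv, Real.inv_rpow h1.le, ← Real.rpow_neg h1.le] at h3
  have h4 : 0 ≤ q * r ^ (q - 1) := by positivity
  calc q * r ^ (q - 1) * -Real.log (1 - r)
      ≤ q * r ^ (q - 1) * ((1 - r) ^ (-(1 / 2) : ℝ) / (1 / 2)) := by gcongr
    _ = _ := by ring

lemma integrable_and_integral_eq_of_lintegral {α : Type*} [MeasurableSpace α] {μ : Measure α}
    {f : α → ℝ} {c : ℝ} (hf : AEStronglyMeasurable f μ) (hpos : 0 ≤ᵐ[μ] f) (hc : 0 ≤ c)
    (h : ∫⁻ x, ENNReal.ofReal (f x) ∂μ = ENNReal.ofReal c) :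
    Integrable f μ ∧ ∫ x, f x ∂μ = c := by
  refine ⟨⟨hf, ?_⟩, ?_⟩
  · rw [hasFiniteIntegral_iff_ofReal hpos, h]
    exact ENNReal.ofReal_lt_top
  · rw [integral_eq_lintegral_of_nonneg_ae hpos hf, h, ENNReal.toReal_ofReal hc]

lemma isProbabilityMeasure_radialMeasure {q : ℝ} (hq : 0 < q) :
    IsProbabilityMeasure (radialMeasure q) := by
  constructor
  have h := lintegral_radialMeasure_of_circleAverage hq (u := fun _ => 1) (m := fun _ => 1)
    (measurable_const.indicator measurableSet_unitDisc) (fun _ _ => zero_le_one)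
    (fun r _ => circleIntegrable_const 1 0 r) (fun r _ => Real.circleAverage_const 1 0 r)
  rw [lintegral_radial_const hq zero_le_one] at h
  simpa using h

lemma aestronglyMeasurable_radialMeasure {q : ℝ} {u : ℂ → ℝ}
    (hu : Measurable (unitDisc.indicator u)) : AEStronglyMeasurable u (radialMeasure q) := by
  refine hu.aestronglyMeasurable.congr ?_
  filter_upwards [ae_radialMeasure_mem q] with w hw
  rw [indicator_of_mem hw]

lemma integral_radialMeasure_re {q : ℝ} (hq : 0 < q) {H : ℂ → ℂ} (hH : DifferentiableOn ℂ H unitDisc)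
    {M : ℝ} (hM : ∀ w ∈ unitDisc, (H w).re ≤ M) :
    Integrable (fun w => (H w).re) (radialMeasure q) ∧
      ∫ w, (H w).re ∂radialMeasure q = (H 0).re := by
  have := isProbabilityMeasure_radialMeasure hq
  have h0 : (0 : ℂ) ∈ unitDisc := by simp [unitDisc]
  have hcont : ContinuousOn (fun w => M - (H w).re) unitDisc :=
    continuousOn_const.sub (Complex.continuous_re.comp_continuousOn hH.continuousOn)
  have hsub : ∀ r ∈ Ioo (0 : ℝ) 1, Metric.closedBall (0 : ℂ) |r| ⊆ unitDisc := fun r hr w hw => by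
    rw [abs_of_pos hr.1, mem_closedBall_zero_iff] at hw
    exact hw.trans_lt hr.2
  have hmeas : Measurable (unitDisc.indicator fun w => M - (H w).re) := by
    classical
    rw [← piecewise_eq_indicator]
    exact hcont.measurable_piecewise continuousOn_const measurableSet_unitDisc
  have hci : ∀ r ∈ Ioo (0 : ℝ) 1, CircleIntegrable (fun w => M - (H w).re) 0 r := fun r hr =>
    (hcont.mono (Metric.sphere_subset_closedBall.trans (hsub r hr))).circleIntegrable'
  have havg : ∀ r ∈ Ioo (0 : ℝ) 1,
      Real.circleAverage (fun w => M - (H w).re) 0 r = M - (H 0).re := fun r hr => by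
    have hd : DiffContOnCl ℂ (fun w => (M : ℂ) - H w) (Metric.ball 0 |r|) := by
      refine DifferentiableOn.diffContOnCl ?_
      refine (hH.const_sub _).mono ?_
      exact Metric.closure_ball_subset_closedBall.trans (hsub r hr)
    have h1 := Complex.reCLM.circleAverage_comp_comm (f := fun w => (M : ℂ) - H w) (c := 0) (R := r)
      (((continuousOn_const.sub hH.continuousOn).mono
        (Metric.sphere_subset_closedBall.trans (hsub r hr))).circleIntegrable')
    rw [hd.circleAverage] at h1
    simpa [Function.comp_def] using h1
  have key := lintegral_radialMeasure_of_circleAverage hq hmeas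
    (fun w hw => sub_nonneg.mpr (hM w hw)) hci havg
  rw [lintegral_radial_const hq (sub_nonneg.mpr (hM 0 h0))] at key
  obtain ⟨k1, k2⟩ := integrable_and_integral_eq_of_lintegral
    (aestronglyMeasurable_radialMeasure hmeas)
    (by filter_upwards [ae_radialMeasure_mem q] with w hw using sub_nonneg.mpr (hM w hw))
    (sub_nonneg.mpr (hM 0 h0)) key
  have k3 : Integrable (fun w => (H w).re) (radialMeasure q) := by
    refine ((integrable_const M).sub k1).congr (Eventually.of_forall fun w => ?_)
    simp
  refine ⟨k3, ?_⟩
  rw [integral_sub (integrable_const M) k3] at k2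
  simp at k2
  exact k2

lemma circleAverage_log_norm_mob {b : ℂ} (hb : b ∈ unitDisc) {r : ℝ} (hr : r ∈ Ioo (0 : ℝ) 1) :
    CircleIntegrable (fun w => Real.log ‖mob b w‖) 0 r ∧
      Real.circleAverage (fun w => Real.log ‖mob b w‖) 0 r = Real.log (max r ‖b‖) := by
  have hsub : Metric.closedBall (0 : ℂ) |r| ⊆ unitDisc := fun w hw => by
    rw [abs_of_pos hr.1, mem_closedBall_zero_iff] at hw
    exact hw.trans_lt hr.2
  have hci : CircleIntegrable (fun w => Real.log ‖mob b w‖) 0 r := by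
    refine MeromorphicOn.circleIntegrable_log_norm (f := mob b) fun w _ => ?_
    unfold mob
    fun_prop
  have hci2 : CircleIntegrable (fun w => Real.log ‖1 - (starRingEnd ℂ) b * w‖) 0 r :=
    MeromorphicOn.circleIntegrable_log_norm (f := fun w => 1 - (starRingEnd ℂ) b * w)
      fun w _ => by fun_prop
  refine ⟨hci, ?_⟩
  have h2 : Real.circleAverage (fun w => Real.log ‖1 - (starRingEnd ℂ) b * w‖) 0 r = 0 := by
    rw [InnerProductSpace.HarmonicOnNhd.circleAverage_eq]
    · simp
    · intro w hw
      exact AnalyticAt.harmonicAt_log_norm (by fun_prop)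
        (one_sub_conj_mul_ne_zero hb (hsub hw))
  have h3 : Real.circleAverage (fun w => Real.log ‖w - b‖) 0 r = Real.log (max r ‖b‖) := by
    rw [circleAverage_log_norm_sub_const_eq_log_radius_add_posLog hr.1.ne', zero_sub, norm_neg]
    rcases le_total ‖b‖ r with h | h
    · rw [max_eq_left h, Real.posLog_eq_zero_iff _ |>.mpr, add_zero]
      rw [abs_of_nonneg (by have := hr.1; positivity), inv_mul_le_iff₀ hr.1, mul_one]
      exact h
    · have hb0 : 0 < ‖b‖ := hr.1.trans_le h
      rw [max_eq_right h, Real.posLog_eq_log, Real.log_mul (inv_ne_zero hr.1.ne') hb0.ne',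
        Real.log_inv]
      · ring
      · rw [abs_of_nonneg (by have := hr.1; positivity), le_inv_mul_iff₀ hr.1, mul_one]
        exact h
  have h4 : Real.circleAverage ((fun w => Real.log ‖mob b w‖) +
      fun w => Real.log ‖1 - (starRingEnd ℂ) b * w‖) 0 r =
      Real.circleAverage (fun w => Real.log ‖w - b‖) 0 r := by
    refine Real.circleAverage_congr_codiscreteWithin ?_ hr.1.ne'
    have hne : {w : ℂ | w ≠ b} ∈ codiscreteWithin (Metric.sphere (0 : ℂ) |r|) := by
      rw [codiscreteWithin_iff_locallyFiniteComplementWithin]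
      intro z _
      refine ⟨univ, univ_mem, (finite_singleton b).subset ?_⟩
      rintro w ⟨_, _, hw⟩
      simpa using hw
    filter_upwards [hne, Filter.self_mem_codiscreteWithin (Metric.sphere (0 : ℂ) |r|)] with w hw hs
    have hw1 := one_sub_conj_mul_ne_zero hb (hsub (Metric.sphere_subset_closedBall hs))
    have hw2 : b - w ≠ 0 := sub_ne_zero.mpr (Ne.symm hw)
    rw [Pi.add_apply, mob, norm_div, Real.log_div (norm_ne_zero_iff.mpr hw2)
      (norm_ne_zero_iff.mpr hw1), sub_add_cancel, norm_sub_rev]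
  rw [Real.circleAverage_add hci hci2, h2, h3, add_zero] at h4
  exact h4

lemma integral_radialMeasure_log_mob {q : ℝ} (hq : 0 < q) {b : ℂ} (hb : b ∈ unitDisc) :
    Integrable (fun w => Real.log ‖mob b w‖) (radialMeasure q) ∧
      ∫ w, Real.log ‖mob b w‖ ∂radialMeasure q = -((1 - ‖b‖ ^ q) / q) := by
  have hb1 : ‖b‖ < 1 := hb
  have hmeas : Measurable (unitDisc.indicator fun w => -Real.log ‖mob b w‖) :=
    ((Real.measurable_log.comp (measurable_mob b).norm).neg).indicator measurableSet_unitDisc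
  have hpos : ∀ w ∈ unitDisc, 0 ≤ -Real.log ‖mob b w‖ := fun w hw => by
    have h : ‖mob b w‖ < 1 := mob_mem hb hw
    linarith [Real.log_nonpos (norm_nonneg _) h.le]
  have key := lintegral_radialMeasure_of_circleAverage hq hmeas hpos
    (fun r hr => (circleAverage_log_norm_mob hb hr).1.neg)
    (m := fun r => -Real.log (max r ‖b‖))
    (fun r hr => by
      rw [← (circleAverage_log_norm_mob hb hr).2, Real.circleAverage_def, Real.circleAverage_def,
        intervalIntegral.integral_neg, smul_neg])
  rw [lintegral_radial_log_max hq (norm_nonneg b) hb1] at key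
  have hc : 0 ≤ (1 - ‖b‖ ^ q) / q :=
    div_nonneg (sub_nonneg.mpr (Real.rpow_le_one (norm_nonneg b) hb1.le hq.le)) hq.le
  obtain ⟨k1, k2⟩ := integrable_and_integral_eq_of_lintegral
    (aestronglyMeasurable_radialMeasure hmeas)
    (by filter_upwards [ae_radialMeasure_mem q] with w hw using hpos w hw) hc key
  rw [integral_neg] at k2
  exact ⟨by simpa using k1.neg, by linarith⟩

lemma integrable_radialMeasure_log_one_sub {q : ℝ} (hq : 0 < q) :
    Integrable (fun w : ℂ => Real.log (1 - ‖w‖)) (radialMeasure q) := by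
  have hmeas : Measurable (unitDisc.indicator fun w : ℂ => -Real.log (1 - ‖w‖)) :=
    ((Real.measurable_log.comp (measurable_norm.const_sub 1)).neg).indicator
      measurableSet_unitDisc
  have hpos : ∀ w ∈ unitDisc, 0 ≤ -Real.log (1 - ‖w‖) := fun w hw => by
    have h : ‖w‖ < 1 := hw
    linarith [Real.log_nonpos (sub_nonneg.mpr h.le) (by linarith [norm_nonneg w])]
  have hcst : ∀ r ∈ Ioo (0 : ℝ) 1, ∀ w ∈ Metric.sphere (0 : ℂ) |r|,
      -Real.log (1 - ‖w‖) = -Real.log (1 - r) := fun r hr w hw => by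
    rw [mem_sphere_zero_iff_norm.mp hw, abs_of_pos hr.1]
  have key := lintegral_radialMeasure_of_circleAverage hq hmeas hpos
    (fun r hr => (continuousOn_const.congr (hcst r hr)).circleIntegrable')
    (fun r hr => Real.circleAverage_const_on_circle (hcst r hr))
  have h : Integrable (fun w : ℂ => -Real.log (1 - ‖w‖)) (radialMeasure q) := by
    refine ⟨aestronglyMeasurable_radialMeasure hmeas, ?_⟩
    rw [hasFiniteIntegral_iff_ofReal
      (by filter_upwards [ae_radialMeasure_mem q] with w hw using hpos w hw), key]
    exact lintegral_radial_log_one_sub_lt_top hq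
  simpa using h.neg

lemma ofReal_exp_integral_le {α : Type*} [MeasurableSpace α] {μ : Measure α}
    [IsProbabilityMeasure μ] {L : α → ℝ} (hL : Integrable L μ) :
    ENNReal.ofReal (Real.exp (∫ x, L x ∂μ)) ≤ ∫⁻ x, ENNReal.ofReal (Real.exp (L x)) ∂μ := by
  by_cases h : ∫⁻ x, ENNReal.ofReal (Real.exp (L x)) ∂μ = ⊤
  · rw [h]; exact le_top
  have hpos : 0 ≤ᵐ[μ] fun x => Real.exp (L x) := Eventually.of_forall fun x => (Real.exp_pos _).le
  have hi : Integrable (fun x => Real.exp (L x)) μ := by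
    refine ⟨Real.continuous_exp.comp_aestronglyMeasurable hL.1, ?_⟩
    rw [hasFiniteIntegral_iff_ofReal hpos]
    exact lt_top_iff_ne_top.mpr h
  rw [← ofReal_integral_eq_lintegral_ofReal hi hpos]
  refine ENNReal.ofReal_le_ofReal ?_
  exact convexOn_exp.map_integral_le Real.continuous_exp.continuousOn isClosed_univ
    (Eventually.of_forall fun _ => mem_univ _) hL hi

lemma exists_mob_norm_le {δ : ℝ} (hδ : 0 < δ) (hδ1 : δ < 1) {w : ℂ} (hw : w ∈ unitDisc) {t : ℝ}
    (ht : t ≤ 1) (h : t * (1 - δ) ≤ 1 - ‖w‖) :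
    ∃ w' ∈ unitDisc, t ≤ 1 - ‖w'‖ ∧ ‖mob w' w‖ ≤ δ := by
  have hw1 : ‖w‖ < 1 := hw
  rcases le_or_gt ‖w‖ δ with hx | hx
  · exact ⟨0, by simp [unitDisc], by simpa using ht, by simpa [mob] using hx⟩
  · have hx0 : 0 < ‖w‖ := hδ.trans hx
    set s : ℝ := (‖w‖ - δ) / (1 - δ) with hs
    have hd : 0 < 1 - δ := by linarith
    have hs0 : 0 ≤ s := div_nonneg (by linarith) hd.le
    have hsd : s * (1 - δ) = ‖w‖ - δ := div_mul_cancel₀ _ hd.ne'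
    have hs1 : s < 1 := by rw [hs, div_lt_one hd]; linarith
    have hsx : s ≤ ‖w‖ := by nlinarith
    have hn : ‖((s / ‖w‖ : ℝ) : ℂ) * w‖ = s := by
      rw [norm_mul, Complex.norm_real, Real.norm_of_nonneg (by positivity),
        div_mul_cancel₀ _ hx0.ne']
    refine ⟨((s / ‖w‖ : ℝ) : ℂ) * w, hn.trans_lt hs1, ?_, ?_⟩
    · rw [hn]
      nlinarith
    · have hnum : ‖((s / ‖w‖ : ℝ) : ℂ) * w - w‖ = ‖w‖ - s := by
        rw [show ((s / ‖w‖ : ℝ) : ℂ) * w - w = ((s / ‖w‖ - 1 : ℝ) : ℂ) * w by push_cast; ring,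
          norm_mul, Complex.norm_real, Real.norm_of_nonpos
            (sub_nonpos.mpr ((div_le_one hx0).mpr hsx))]
        field_simp
        ring
      have hden : 1 - s ≤ ‖1 - (starRingEnd ℂ) (((s / ‖w‖ : ℝ) : ℂ) * w) * w‖ := by
        have h1 := norm_sub_norm_le 1 ((starRingEnd ℂ) (((s / ‖w‖ : ℝ) : ℂ) * w) * w)
        rw [norm_mul, RCLike.norm_conj, hn, norm_one] at h1
        nlinarith
      rw [mob, norm_div, hnum, div_le_iff₀ (by linarith)]
      nlinarith

lemma pow_mul_le_of_mob {W : ℂ → ℝ} {r C δ : ℝ} (hδ : 0 < δ) (hδ1 : δ < 1) (hδr : δ < r)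
    (hC : 1 ≤ C)
    (hinv : ∀ a ∈ unitDisc, ∀ z ∈ unitDisc, ‖mob a z‖ < r → C⁻¹ * W a ≤ W z)
    {z : ℂ} (hz : z ∈ unitDisc) (n : ℕ) :
    ∀ w ∈ unitDisc, (1 - δ) ^ n ≤ 1 - ‖w‖ → C⁻¹ ^ n * W z ≤ W (mob z w) := by
  have hC0 : 0 < C := by linarith
  induction n with
  | zero =>
    intro w _ h
    have : w = 0 := norm_le_zero_iff.mp (by simpa using h)
    simp [this]
  | succ n ih =>
    intro w hw h
    obtain ⟨w', hw', h1, h2⟩ := exists_mob_norm_le hδ hδ1 hw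
      (pow_le_one₀ (n := n) (by linarith) (by linarith : 1 - δ ≤ 1)) (by rwa [← pow_succ])
    have h3 := hinv (mob z w') (mob_mem hz hw') (mob z w) (mob_mem hz hw)
      (by rw [mob_mob_mob hz hw' hw]; exact h2.trans_lt hδr)
    refine le_trans ?_ h3
    rw [pow_succ', mul_assoc]
    exact mul_le_mul_of_nonneg_left (ih w' hw' h1) (by positivity)

lemma IsInvariantWeight.exists_growth {W : ℂ → ℝ} (hpos : ∀ z ∈ unitDisc, 0 < W z)
    (hinv : IsInvariantWeight W) :
    ∃ c K : ℝ, 0 < c ∧ 0 ≤ K ∧ ∀ z ∈ unitDisc, ∀ w ∈ unitDisc,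
      c * W z * (1 - ‖w‖) ^ K ≤ W (mob z w) := by
  obtain ⟨r, hr0, hr1, C, hC, h⟩ := hinv
  have hC0 : 0 < C := by linarith
  set δ := r / 2 with hδ
  have hd : Real.log (1 - δ) < 0 := Real.log_neg (by linarith) (by linarith)
  refine ⟨C⁻¹, Real.log C / (-Real.log (1 - δ)), by positivity,
    div_nonneg (Real.log_nonneg hC) (by linarith), fun z hz w hw => ?_⟩
  have hw1 : ‖w‖ < 1 := hw
  have hx : 0 < 1 - ‖w‖ := by linarith
  set t := Real.log (1 - ‖w‖) / Real.log (1 - δ) with ht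
  have ht0 : 0 ≤ t :=
    div_nonneg_of_nonpos (Real.log_nonpos hx.le (by linarith [norm_nonneg w])) hd.le
  have h1 : (1 - δ) ^ ⌈t⌉₊ ≤ 1 - ‖w‖ := by
    rw [← Real.log_le_log_iff (by have : 0 < 1 - δ := by linarith
                                  positivity) hx, Real.log_pow]
    have := mul_le_mul_of_nonpos_right (Nat.le_ceil t) hd.le
    rwa [ht, div_mul_cancel₀ _ hd.ne] at this
  have h2 := pow_mul_le_of_mob (by linarith) (by linarith) (by linarith : δ < r) hC
    (fun a ha z hz hh => (h a ha z hz hh).1) hz _ w hw h1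
  refine le_trans ?_ h2
  have h3 : (1 - ‖w‖) ^ (Real.log C / (-Real.log (1 - δ))) = C⁻¹ ^ t := by
    rw [Real.rpow_def_of_pos hx, Real.rpow_def_of_pos (by positivity), Real.log_inv, ht]
    congr 1
    field_simp
  have h4 : C⁻¹ * C⁻¹ ^ t ≤ C⁻¹ ^ ⌈t⌉₊ := by
    rw [← Real.rpow_natCast, mul_comm, ← Real.rpow_add_one (by positivity)]
    exact Real.rpow_le_rpow_of_exponent_ge (by positivity) (inv_le_one_of_one_le₀ hC)
      (Nat.ceil_lt_add_one ht0).le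
  rw [h3, mul_right_comm]
  exact mul_le_mul_of_nonneg_right h4 (hpos z hz).le

lemma le_one_sub_norm_mob_sq {z w : ℂ} (hz : z ∈ unitDisc) (hw : w ∈ unitDisc) :
    (1 - ‖z‖ ^ 2) * (1 - ‖w‖) / 4 ≤ 1 - ‖mob z w‖ ^ 2 := by
  have hz1 : ‖z‖ < 1 := hz
  have hw1 : ‖w‖ < 1 := hw
  have h0 : 0 < ‖1 - (starRingEnd ℂ) z * w‖ :=
    norm_pos_iff.mpr (one_sub_conj_mul_ne_zero hz hw)
  have h2 : ‖1 - (starRingEnd ℂ) z * w‖ ≤ 2 := by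
    have h1 := norm_sub_le 1 ((starRingEnd ℂ) z * w)
    rw [norm_mul, RCLike.norm_conj, norm_one] at h1
    nlinarith [norm_nonneg z, norm_nonneg w]
  have hz2 := one_sub_sq_pos hz
  rw [one_sub_norm_mob_sq hz hw]
  have h3 : 1 - ‖w‖ ≤ 1 - ‖w‖ ^ 2 := by nlinarith [norm_nonneg w]
  gcongr
  · nlinarith [norm_nonneg w]
  · nlinarith

lemma IsInvariantWeight.exists_growth_mul {W : ℂ → ℝ} (hpos : ∀ z ∈ unitDisc, 0 < W z)
    (hinv : IsInvariantWeight W) :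
    ∃ c K : ℝ, 0 < c ∧ ∀ z ∈ unitDisc, ∀ w ∈ unitDisc,
      c * ((1 - ‖z‖ ^ 2) ^ 2 * W z) * (1 - ‖w‖) ^ K ≤
        (1 - ‖mob z w‖ ^ 2) ^ 2 * W (mob z w) := by
  obtain ⟨c, K, hc, hK, h⟩ := hinv.exists_growth hpos
  refine ⟨c / 16, K + 2, by positivity, fun z hz w hw => ?_⟩
  have hw1 : ‖w‖ < 1 := hw
  have hx : 0 < 1 - ‖w‖ := by linarith
  have h1 := le_one_sub_norm_mob_sq hz hw
  have hz2 := one_sub_sq_pos hz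
  have hWz := hpos z hz
  calc c / 16 * ((1 - ‖z‖ ^ 2) ^ 2 * W z) * (1 - ‖w‖) ^ (K + 2)
      = ((1 - ‖z‖ ^ 2) * (1 - ‖w‖) / 4) ^ 2 * (c * W z * (1 - ‖w‖) ^ K) := by
        rw [Real.rpow_add hx, Real.rpow_two]
        ring
    _ ≤ _ := by
        gcongr
        exact h z hz w hw

/-- The zero-free function `exp H` times the finite Blaschke product with zeros `a i`, `i ∈ s`. -/
def expMulBlaschke {ι : Type} (H : ℂ → ℂ) (s : Finset ι) (a : ι → ℂ) (u : ℂ) : ℂ :=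
  Complex.exp (H u) * ∏ i ∈ s, mob (a i) u

lemma differentiableOn_expMulBlaschke {ι : Type} {H : ℂ → ℂ} {s : Finset ι} {a : ι → ℂ}
    (hH : DifferentiableOn ℂ H unitDisc) (ha : ∀ i, a i ∈ unitDisc) :
    DifferentiableOn ℂ (expMulBlaschke H s a) unitDisc := by
  unfold expMulBlaschke
  refine hH.cexp.mul ?_
  exact DifferentiableOn.fun_finsetProd fun i _ => differentiableOn_mob (ha i)

lemma norm_expMulBlaschke_rpow {ι : Type} (H : ℂ → ℂ) (s : Finset ι) (a : ι → ℂ) (u : ℂ) (e : ℝ) :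
    ‖expMulBlaschke H s a u‖ ^ e = Real.exp (e * (H u).re) * ∏ i ∈ s, ‖mob (a i) u‖ ^ e := by
  rw [expMulBlaschke, norm_mul, Complex.norm_exp, norm_prod,
    Real.mul_rpow (Real.exp_pos _).le (Finset.prod_nonneg fun _ _ => norm_nonneg _),
    ← Real.exp_mul, Real.finsetProd_rpow _ _ fun _ _ => norm_nonneg _, mul_comm e]

lemma exists_ofReal_exp_le_lintegral {W : ℂ → ℝ} (hpos : ∀ z ∈ unitDisc, 0 < W z)
    (hinv : IsInvariantWeight W) {q : ℝ} (hq : 0 < q) :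
    ∃ C : ℝ, 0 < C ∧ ∀ {ι : Type} (s : Finset ι) (a : ι → ℂ), (∀ i, a i ∈ unitDisc) →
      ∀ (H : ℂ → ℂ), DifferentiableOn ℂ H unitDisc → ∀ M : ℝ, (∀ w ∈ unitDisc, (H w).re ≤ M) →
      ∀ e : ℝ, 0 < e → ∀ z ∈ unitDisc,
      ENNReal.ofReal (Real.exp (e * ((H z).re - ∑ i ∈ s, (1 - ‖mob (a i) z‖ ^ q) / q)) *
          ((1 - ‖z‖ ^ 2) ^ 2 * W z)) ≤
        ENNReal.ofReal C * ∫⁻ w, ENNReal.ofReal (‖expMulBlaschke H s a (mob z w)‖ ^ e *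
          ((1 - ‖mob z w‖ ^ 2) ^ 2 * W (mob z w))) ∂radialMeasure q := by
  obtain ⟨c, K, hc, hgr⟩ := hinv.exists_growth_mul hpos
  have := isProbabilityMeasure_radialMeasure hq
  set κ := ∫ w : ℂ, Real.log (1 - ‖w‖) ∂radialMeasure q with hκ
  refine ⟨(c * Real.exp (K * κ))⁻¹, by positivity, fun s a ha H hH M hM e he z hz => ?_⟩
  set J : ℝ := (1 - ‖z‖ ^ 2) ^ 2 * W z with hJ
  have hJ0 : 0 ≤ J := mul_nonneg (sq_nonneg _) (hpos z hz).le
  obtain ⟨i1, v1⟩ := integral_radialMeasure_re hq (H := fun w => H (mob z w))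
    (hH.comp (differentiableOn_mob hz) fun w hw => mob_mem hz hw) (M := M)
    (fun w hw => hM _ (mob_mem hz hw))
  have i2 : ∀ i, Integrable (fun w => Real.log ‖mob (mob z (a i)) w‖) (radialMeasure q) :=
    fun i => (integral_radialMeasure_log_mob hq (mob_mem hz (ha i))).1
  have v2 : ∀ i, ∫ w, Real.log ‖mob (mob z (a i)) w‖ ∂radialMeasure q =
      -((1 - ‖mob (a i) z‖ ^ q) / q) := fun i => by
    rw [(integral_radialMeasure_log_mob hq (mob_mem hz (ha i))).2, norm_mob_comm z]
  have i2s := integrable_finsetSum s fun i _ => i2 i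
  have i3 := integrable_radialMeasure_log_one_sub hq
  set L : ℂ → ℝ := fun w => e * ((H (mob z w)).re +
    ∑ i ∈ s, Real.log ‖mob (mob z (a i)) w‖) + K * Real.log (1 - ‖w‖) with hL
  have iL : Integrable L (radialMeasure q) := ((i1.add i2s).const_mul e).add (i3.const_mul K)
  have vL : ∫ w, L w ∂radialMeasure q =
      e * ((H z).re - ∑ i ∈ s, (1 - ‖mob (a i) z‖ ^ q) / q) + K * κ := by
    have h1 := integral_add ((i1.add i2s).const_mul e) (i3.const_mul K)
    have h2 := integral_add i1 i2s
    simp only [Pi.add_apply] at h1 h2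
    rw [hL, h1, integral_const_mul, integral_const_mul, h2, v1,
      integral_finsetSum s fun i _ => i2 i, Finset.sum_congr rfl fun i _ => v2 i,
      Finset.sum_neg_distrib, mob_zero, ← sub_eq_add_neg]
  have hexp := ofReal_exp_integral_le iL
  have hle : ∀ᵐ w ∂radialMeasure q, ENNReal.ofReal (c * J) * ENNReal.ofReal (Real.exp (L w)) ≤
      ENNReal.ofReal (‖expMulBlaschke H s a (mob z w)‖ ^ e *
          ((1 - ‖mob z w‖ ^ 2) ^ 2 * W (mob z w))) := by
    have hne : ∀ᵐ w ∂radialMeasure q, ∀ i ∈ s, w ≠ mob z (a i) :=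
      (ae_ball_iff s.countable_toSet).mpr fun i _ => ae_radialMeasure_ne q _
    filter_upwards [ae_radialMeasure_mem q, hne] with w hw hne
    have hx : 0 < 1 - ‖w‖ := sub_pos.mpr hw
    have hb : ∀ i ∈ s, 0 < ‖mob (mob z (a i)) w‖ := fun i hi => norm_pos_iff.mpr fun h =>
      hne i hi ((mob_eq_zero_iff (mob_mem hz (ha i)) hw).mp h)
    have hE : Real.exp (L w) = ‖expMulBlaschke H s a (mob z w)‖ ^ e * (1 - ‖w‖) ^ K := by
      rw [norm_expMulBlaschke_rpow, hL]
      simp only []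
      rw [Real.exp_add, mul_add, Real.exp_add, Finset.mul_sum, Real.exp_sum,
        Real.rpow_def_of_pos hx, mul_comm K]
      congr 2
      refine Finset.prod_congr rfl fun i hi => ?_
      rw [norm_mob_mob (ha i) hz hw, Real.rpow_def_of_pos (hb i hi), mul_comm]
    rw [← ENNReal.ofReal_mul (by positivity), hE]
    refine ENNReal.ofReal_le_ofReal ?_
    calc c * J * (‖expMulBlaschke H s a (mob z w)‖ ^ e * (1 - ‖w‖) ^ K)
        = ‖expMulBlaschke H s a (mob z w)‖ ^ e * (c * J * (1 - ‖w‖) ^ K) := by ring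
      _ ≤ _ := mul_le_mul_of_nonneg_left (hgr z hz w hw) (by positivity)
  calc ENNReal.ofReal (Real.exp (e * ((H z).re - ∑ i ∈ s, (1 - ‖mob (a i) z‖ ^ q) / q)) * J)
      = ENNReal.ofReal (c * Real.exp (K * κ))⁻¹ *
          (ENNReal.ofReal (c * J) * ENNReal.ofReal (Real.exp (∫ w, L w ∂radialMeasure q))) := by
        rw [← ENNReal.ofReal_mul (by positivity), ← ENNReal.ofReal_mul (by positivity), vL,
          Real.exp_add]
        congr 1
        field_simp
    _ ≤ ENNReal.ofReal (c * Real.exp (K * κ))⁻¹ *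
          (ENNReal.ofReal (c * J) * ∫⁻ w, ENNReal.ofReal (Real.exp (L w)) ∂radialMeasure q) := by
        gcongr
    _ ≤ _ := by
        rw [← lintegral_const_mul' _ _ ENNReal.ofReal_ne_top]
        gcongr 1
        exact lintegral_mono_ae hle

/-- The density of the image of `radialMeasure q` under `mob z`, relative to the factor
`(1 - ‖z‖ ^ 2) ^ 2`. -/
def mobKernel (q : ℝ) (z u : ℂ) : ENNReal :=
  ENNReal.ofReal ((‖1 - (starRingEnd ℂ) z * u‖ ^ 4)⁻¹ * (q / (2 * Real.pi) * ‖mob z u‖ ^ (q - 2)))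

lemma mobKernel_comm (q : ℝ) (z u : ℂ) : mobKernel q z u = mobKernel q u z := by
  rw [mobKernel, mobKernel, norm_mob_comm, norm_one_sub_conj_mul_comm]

lemma measurable_mobKernel (q : ℝ) : Measurable fun x : ℂ × ℂ => mobKernel q x.1 x.2 := by
  have h := measurable_mob₂.norm
  have h1 : Measurable fun x : ℂ × ℂ => (starRingEnd ℂ) x.1 :=
    Complex.continuous_conj.measurable.comp measurable_fst
  unfold mobKernel
  fun_prop

lemma lintegral_radialMeasure_comp_mob (q : ℝ) {z : ℂ} (hz : z ∈ unitDisc) (Φ : ℂ → ENNReal) :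
    ENNReal.ofReal (((1 - ‖z‖ ^ 2) ^ 2)⁻¹) * ∫⁻ w, Φ (mob z w) ∂radialMeasure q =
      ∫⁻ u in unitDisc, mobKernel q z u * Φ u := by
  have hz2 := one_sub_sq_pos hz
  rw [radialMeasure, lintegral_withDensity_eq_lintegral_mul_non_measurable _
    (measurable_radialDensity q) (Eventually.of_forall fun _ => ENNReal.ofReal_lt_top),
    lintegral_comp_mob hz, ← lintegral_const_mul' _ _ ENNReal.ofReal_ne_top]
  refine setLIntegral_congr_fun measurableSet_unitDisc fun u hu => ?_
  simp only [Pi.mul_apply, mob_involutive hz hu, mobKernel]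
  rw [← mul_assoc, ← mul_assoc, ← ENNReal.ofReal_mul (by positivity),
    ← ENNReal.ofReal_mul (by positivity)]
  congr 2
  field_simp

lemma lintegral_lintegral_radialMeasure_comp_mob {q : ℝ} (hq : 0 < q) {Φ : ℂ → ENNReal}
    (hΦ : AEMeasurable Φ (volume.restrict unitDisc)) :
    ∫⁻ z in unitDisc, ENNReal.ofReal (((1 - ‖z‖ ^ 2) ^ 2)⁻¹) *
        ∫⁻ w, Φ (mob z w) ∂radialMeasure q =
      ∫⁻ u in unitDisc, ENNReal.ofReal (((1 - ‖u‖ ^ 2) ^ 2)⁻¹) * Φ u := by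
  have := isProbabilityMeasure_radialMeasure hq
  rw [setLIntegral_congr_fun measurableSet_unitDisc
    fun z hz => lintegral_radialMeasure_comp_mob q hz Φ, lintegral_lintegral_swap]
  · refine setLIntegral_congr_fun measurableSet_unitDisc fun u hu => ?_
    have h := lintegral_radialMeasure_comp_mob q hu fun _ => 1
    simp only [lintegral_const, measure_univ, mul_one] at h
    have hm : Measurable (mobKernel q u) := (measurable_mobKernel q).of_uncurry_left
    rw [h, ← lintegral_mul_const _ hm]
    exact lintegral_congr fun z => by rw [mobKernel_comm]
  · exact (measurable_mobKernel q).aemeasurable.mul hΦ.comp_snd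

lemma aemeasurable_norm_rpow_mul {W : ℂ → ℝ} (hWi : IntegrableOn W unitDisc) {f : ℂ → ℂ}
    (hf : DifferentiableOn ℂ f unitDisc) (e : ℝ) :
    AEMeasurable (fun z => ‖f z‖ ^ e * W z) (volume.restrict unitDisc) :=
  ((hf.continuousOn.aemeasurable measurableSet_unitDisc).norm.pow_const e).mul
    hWi.1.aemeasurable

lemma exists_lintegral_exp_le {W : ℂ → ℝ} (hW : IsWeight W)
    (hinv : IsInvariantWeight W) {q : ℝ} (hq : 0 < q) :
    ∃ C : ℝ, 0 < C ∧ ∀ {ι : Type} (s : Finset ι) (a : ι → ℂ), (∀ i, a i ∈ unitDisc) →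
      ∀ (H : ℂ → ℂ), DifferentiableOn ℂ H unitDisc → ∀ M : ℝ, (∀ w ∈ unitDisc, (H w).re ≤ M) →
      ∀ e : ℝ, 0 < e →
      ∫⁻ z in unitDisc, ENNReal.ofReal
          (Real.exp (e * ((H z).re - ∑ i ∈ s, (1 - ‖mob (a i) z‖ ^ q) / q)) * W z) ≤
        ENNReal.ofReal C *
          ∫⁻ u in unitDisc, ENNReal.ofReal (‖expMulBlaschke H s a u‖ ^ e * W u) := by
  obtain ⟨C, hC, h⟩ := exists_ofReal_exp_le_lintegral hW.1 hinv hq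
  refine ⟨C, hC, fun s a ha H hH M hM e he => ?_⟩
  set Φ : ℂ → ENNReal := fun u => ENNReal.ofReal (‖expMulBlaschke H s a u‖ ^ e *
    ((1 - ‖u‖ ^ 2) ^ 2 * W u)) with hΦ
  have hΦm : AEMeasurable Φ (volume.restrict unitDisc) := by
    have h1 := aemeasurable_norm_rpow_mul hW.2 (differentiableOn_expMulBlaschke (s := s) hH ha) e
    have h2 : Measurable fun u : ℂ => (1 - ‖u‖ ^ 2) ^ 2 := by fun_prop
    refine ((h2.aemeasurable.mul h1).ennreal_ofReal).congr (Eventually.of_forall fun u => ?_)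
    simp only [hΦ, Pi.mul_apply]
    congr 1
    ring
  have hR := lintegral_lintegral_radialMeasure_comp_mob hq hΦm
  have hR' : ∫⁻ u in unitDisc, ENNReal.ofReal (((1 - ‖u‖ ^ 2) ^ 2)⁻¹) * Φ u =
      ∫⁻ u in unitDisc, ENNReal.ofReal (‖expMulBlaschke H s a u‖ ^ e * W u) := by
    refine setLIntegral_congr_fun measurableSet_unitDisc fun u hu => ?_
    have hu2 := one_sub_sq_pos hu
    simp only [hΦ]
    rw [← ENNReal.ofReal_mul (by positivity)]
    congr 1
    field_simp
  rw [← hR', ← hR, ← lintegral_const_mul' _ _ ENNReal.ofReal_ne_top]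
  refine setLIntegral_mono' measurableSet_unitDisc fun z hz => ?_
  have hz2 := one_sub_sq_pos hz
  rw [mul_left_comm]
  refine le_trans (le_of_eq ?_) (mul_le_mul_right (h s a ha H hH M hM e he z hz) _)
  rw [← ENNReal.ofReal_mul (by positivity)]
  congr 1
  field_simp

lemma log_le_neg_one_sub_sq_div_two {x : ℝ} (hx : 0 < x) : Real.log x ≤ -((1 - x ^ 2) / 2) := by
  have h := Real.log_le_sub_one_of_pos (pow_pos hx 2)
  rw [Real.log_pow] at h
  push_cast at h
  linarith

lemma exists_local_bound {W : ℂ → ℝ} (hW : IsWeight W) (hinv : IsInvariantWeight W) :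
    ∃ C : ℝ → ℝ, (∀ ρ < 1, 0 < C ρ) ∧ ∀ {ι : Type} (s : Finset ι) (a : ι → ℂ),
      (∀ i, a i ∈ unitDisc) →
      ∀ (H : ℂ → ℂ), DifferentiableOn ℂ H unitDisc → ∀ M : ℝ, (∀ w ∈ unitDisc, (H w).re ≤ M) →
      ∀ e : ℝ, 0 < e → ∀ ρ < 1, ∀ z : ℂ, ‖z‖ ≤ ρ →
      ENNReal.ofReal (‖expMulBlaschke H s a z‖ ^ e) ≤ ENNReal.ofReal (C ρ) *
        ∫⁻ u in unitDisc, ENNReal.ofReal (‖expMulBlaschke H s a u‖ ^ e * W u) := by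
  obtain ⟨C, hC, h⟩ := exists_ofReal_exp_le_lintegral hW.1 hinv two_pos
  obtain ⟨c, K, hc, hK, hgr⟩ := hinv.exists_growth hW.1
  have h0 : (0 : ℂ) ∈ unitDisc := by simp [unitDisc]
  have hW0 := hW.1 0 h0
  refine ⟨fun ρ => (c * W 0 * (1 - ρ) ^ K)⁻¹ * (C * (((1 - ρ) ^ 4)⁻¹ * Real.pi⁻¹)),
    fun ρ hρ => ?_, fun s a ha H hH M hM e he ρ hρ z hzρ => ?_⟩
  · have : 0 < 1 - ρ := by linarith
    positivity
  have hρ0 : 0 < 1 - ρ := by linarith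
  have hz : z ∈ unitDisc := hzρ.trans_lt hρ
  have hz1 : ‖z‖ < 1 := hz
  have hz2 := one_sub_sq_pos hz
  have hWz : c * W 0 * (1 - ρ) ^ K ≤ W z := by
    have h1 := hgr 0 h0 (-z) (by simpa [unitDisc] using hz)
    have h2 : mob 0 (-z) = z := by simp [mob]
    rw [h2, norm_neg] at h1
    refine le_trans ?_ h1
    gcongr
  have hWz0 := hW.1 z hz
  have hnorm : ‖expMulBlaschke H s a z‖ ^ e ≤
      Real.exp (e * ((H z).re - ∑ i ∈ s, (1 - ‖mob (a i) z‖ ^ (2 : ℝ)) / 2)) := by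
    rw [norm_expMulBlaschke_rpow, mul_sub, sub_eq_add_neg, Real.exp_add]
    gcongr
    rw [Finset.mul_sum, ← Finset.sum_neg_distrib, Real.exp_sum]
    refine Finset.prod_le_prod (fun i _ => by positivity) fun i _ => ?_
    rcases (norm_nonneg (mob (a i) z)).eq_or_lt with hx | hx
    · rw [← hx, Real.zero_rpow he.ne']
      positivity
    · rw [Real.rpow_def_of_pos hx, Real.rpow_two]
      refine Real.exp_le_exp.mpr ?_
      nlinarith [log_le_neg_one_sub_sq_div_two hx]
  have hker : ∀ u ∈ unitDisc, mobKernel 2 z u ≤ ENNReal.ofReal (((1 - ρ) ^ 4)⁻¹ * Real.pi⁻¹) := by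
    intro u hu
    have hu1 : ‖u‖ < 1 := hu
    have hden : 1 - ρ ≤ ‖1 - (starRingEnd ℂ) z * u‖ := by
      have h1 := norm_sub_norm_le 1 ((starRingEnd ℂ) z * u)
      rw [norm_mul, RCLike.norm_conj, norm_one] at h1
      nlinarith [norm_nonneg u, norm_nonneg z]
    refine ENNReal.ofReal_le_ofReal ?_
    rw [sub_self, Real.rpow_zero, mul_one, show (2 : ℝ) / (2 * Real.pi) = Real.pi⁻¹ by field_simp]
    gcongr
  have hmain := h s a ha H hH M hM e he z hz
  have hstep : ENNReal.ofReal (‖expMulBlaschke H s a z‖ ^ e * W z) ≤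
      ENNReal.ofReal C * ∫⁻ u in unitDisc, mobKernel 2 z u *
        ENNReal.ofReal (‖expMulBlaschke H s a u‖ ^ e * ((1 - ‖u‖ ^ 2) ^ 2 * W u)) := by
    rw [← lintegral_radialMeasure_comp_mob 2 hz fun u =>
      ENNReal.ofReal (‖expMulBlaschke H s a u‖ ^ e * ((1 - ‖u‖ ^ 2) ^ 2 * W u)), mul_left_comm]
    refine le_trans ?_ (mul_le_mul_right hmain _)
    rw [← ENNReal.ofReal_mul (by positivity)]
    refine ENNReal.ofReal_le_ofReal ?_
    rw [mul_left_comm, inv_mul_cancel_left₀ (by positivity)]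
    gcongr
  have hstep2 : ∫⁻ u in unitDisc, mobKernel 2 z u *
        ENNReal.ofReal (‖expMulBlaschke H s a u‖ ^ e * ((1 - ‖u‖ ^ 2) ^ 2 * W u)) ≤
      ENNReal.ofReal (((1 - ρ) ^ 4)⁻¹ * Real.pi⁻¹) *
        ∫⁻ u in unitDisc, ENNReal.ofReal (‖expMulBlaschke H s a u‖ ^ e * W u) := by
    rw [← lintegral_const_mul' _ _ ENNReal.ofReal_ne_top]
    refine setLIntegral_mono' measurableSet_unitDisc fun u hu => ?_
    have hWu := hW.1 u hu
    have hu2 := one_sub_sq_pos hu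
    refine mul_le_mul' (hker u hu) (ENNReal.ofReal_le_ofReal ?_)
    refine mul_le_mul_of_nonneg_left ?_ (by positivity)
    refine mul_le_of_le_one_left hWu.le (pow_le_one₀ hu2.le ?_)
    nlinarith [norm_nonneg u]
  rw [ENNReal.ofReal_mul (by positivity), ENNReal.ofReal_mul hC.le, mul_assoc (ENNReal.ofReal _),
    mul_assoc (ENNReal.ofReal C)]
  refine le_trans ?_ (mul_le_mul_right (hstep.trans (mul_le_mul_right hstep2 _)) _)
  rw [← ENNReal.ofReal_mul (by positivity)]
  refine ENNReal.ofReal_le_ofReal ?_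
  rw [inv_mul_eq_div, le_div_iff₀ (by positivity)]
  gcongr

/-- `g` is represented on the disc as `exp H` times a finite Blaschke product, with `re H`
bounded above. -/
def HasExpBlaschke (g : ℂ → ℂ) : Prop :=
  ∃ (n : ℕ) (a : Fin n → ℂ) (H : ℂ → ℂ) (M : ℝ), (∀ i, a i ∈ unitDisc) ∧
    DifferentiableOn ℂ H unitDisc ∧ (∀ u ∈ unitDisc, (H u).re ≤ M) ∧
    ∀ u ∈ unitDisc, g u = expMulBlaschke H Finset.univ a u

lemma HasExpBlaschke.mob_mul {g : ℂ → ℂ} (hg : HasExpBlaschke g) {b : ℂ} (hb : b ∈ unitDisc) :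
    HasExpBlaschke fun u => mob b u * g u := by
  obtain ⟨n, a, H, M, ha, hH, hM, h⟩ := hg
  refine ⟨n + 1, Fin.cons b a, H, M, fun i => ?_, hH, hM, fun u hu => ?_⟩
  · refine Fin.cases ?_ (fun j => ?_) i
    · simpa using hb
    · simpa using ha j
  · simp only [h u hu, expMulBlaschke, Fin.prod_univ_succ, Fin.cons_zero, Fin.cons_succ]
    ring

lemma HasExpBlaschke.exp_mul {g : ℂ → ℂ} (hg : HasExpBlaschke g) {h : ℂ → ℂ}
    (hh : DifferentiableOn ℂ h unitDisc) {M : ℝ} (hM : ∀ u ∈ unitDisc, (h u).re ≤ M) :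
    HasExpBlaschke fun u => Complex.exp (h u) * g u := by
  obtain ⟨n, a, H, M', ha, hH, hM', hg⟩ := hg
  refine ⟨n, a, fun u => h u + H u, M + M', ha, hh.add hH, fun u hu => ?_, fun u hu => ?_⟩
  · rw [Complex.add_re]
    exact add_le_add (hM u hu) (hM' u hu)
  · simp only [hg u hu, expMulBlaschke, Complex.exp_add]
    ring

lemma HasExpBlaschke.congr {f g : ℂ → ℂ} (hg : HasExpBlaschke g) (h : ∀ u ∈ unitDisc, f u = g u) :
    HasExpBlaschke f := by
  obtain ⟨n, a, H, M, ha, hH, hM, hg⟩ := hg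
  exact ⟨n, a, H, M, ha, hH, hM, fun u hu => (h u hu).trans (hg u hu)⟩

lemma HasExpBlaschke.const_mul {g : ℂ → ℂ} (hg : HasExpBlaschke g) {d : ℂ} (hd : d ≠ 0) :
    HasExpBlaschke fun u => d * g u :=
  (hg.exp_mul (h := fun _ => Complex.log d) (differentiableOn_const _) fun _ _ => le_rfl).congr
    fun u _ => by rw [Complex.exp_log hd]

lemma HasExpBlaschke.one_sub_mul {g : ℂ → ℂ} (hg : HasExpBlaschke g) {c : ℂ} (hc : ‖c‖ ≤ 1) :
    HasExpBlaschke fun u => (1 - c * u) * g u := by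
  have hcu : ∀ u ∈ unitDisc, ‖c * u‖ < 1 := fun u hu => by
    have hu1 : ‖u‖ < 1 := hu
    rw [norm_mul]
    nlinarith [norm_nonneg u, norm_nonneg c]
  have hre : ∀ u ∈ unitDisc, 0 < (1 - c * u).re := fun u hu => by
    have := (Complex.re_le_norm (c * u)).trans_lt (hcu u hu)
    rw [Complex.sub_re, Complex.one_re]
    linarith
  have hne : ∀ u ∈ unitDisc, 1 - c * u ≠ 0 := fun u hu h => by
    have := hre u hu
    simp [h] at this
  refine (hg.exp_mul (h := fun u => Complex.log (1 - c * u)) (M := Real.log 2) ?_ ?_).congr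
    fun u hu => by rw [Complex.exp_log (hne u hu)]
  · exact DifferentiableOn.clog (by fun_prop) fun u hu => Or.inl (hre u hu)
  · intro u hu
    rw [Complex.log_re]
    refine Real.log_le_log (norm_pos_iff.mpr (hne u hu)) ?_
    have h1 := norm_sub_le 1 (c * u)
    rw [norm_one] at h1
    linarith [hcu u hu]

lemma HasExpBlaschke.sub_mul {g : ℂ → ℂ} (hg : HasExpBlaschke g) (b : ℂ) :
    HasExpBlaschke fun u => (u - b) * g u := by
  rcases lt_or_ge ‖b‖ 1 with hb | hb
  · have hc : ‖(starRingEnd ℂ) b‖ ≤ 1 := by rw [RCLike.norm_conj]; exact hb.le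
    refine (((hg.one_sub_mul hc).mob_mul hb).const_mul (neg_ne_zero.mpr one_ne_zero)).congr
      fun u hu => ?_
    have := one_sub_conj_mul_ne_zero (a := b) hb hu
    rw [mob, ← mul_assoc (_ / _), div_mul_cancel₀ _ this]
    ring
  · have hb0 : b ≠ 0 := norm_pos_iff.mp (by linarith)
    have hc : ‖b⁻¹‖ ≤ 1 := by rw [norm_inv]; exact inv_le_one_of_one_le₀ hb
    refine ((hg.one_sub_mul hc).const_mul (neg_ne_zero.mpr hb0)).congr fun u hu => ?_
    field_simp
    ring

lemma hasExpBlaschke_one : HasExpBlaschke fun _ => 1 :=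
  ⟨0, Fin.elim0, fun _ => 0, 0, fun i => i.elim0, differentiableOn_const _, fun _ _ => by simp,
    fun u _ => by simp [expMulBlaschke]⟩

lemma hasExpBlaschke_eval {P : Polynomial ℂ} (hP : P ≠ 0) : HasExpBlaschke fun u => P.eval u := by
  have hprod : ∀ s : Multiset ℂ, HasExpBlaschke fun u => (s.map fun b => u - b).prod := fun s => by
    induction s using Multiset.induction_on with
    | empty => simpa using hasExpBlaschke_one
    | cons b s ih => simpa using ih.sub_mul b
  refine ((hprod P.roots).const_mul (Polynomial.leadingCoeff_ne_zero.mpr hP)).congr fun u _ => ?_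
  conv_lhs => rw [(IsAlgClosed.splits P).eq_prod_roots]
  simp [Polynomial.eval_mul, Polynomial.eval_multiset_prod, Multiset.map_map]

lemma sum_powerset_rpow_le {ι : Type} [DecidableEq ι] {σ τ q : ℝ} (hσ : 0 < σ) (hτ : 0 < τ)
    (hστ : σ + τ = 1) (hq : 0 < q) (s : Finset ι) (a : ι → ℂ) (H : ℂ → ℂ) (z : ℂ) :
    ∑ t ∈ s.powerset, ((∏ _i ∈ t, σ) * ∏ _i ∈ s \ t, τ) *
        ‖expMulBlaschke (fun u => (σ : ℂ) * H u) t a z‖ ^ q ≤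
      Real.exp (σ * q * ((H z).re - ∑ i ∈ s, (1 - ‖mob (a i) z‖ ^ q) / q)) := by
  have h1 : ∑ t ∈ s.powerset, ((∏ _i ∈ t, σ) * ∏ _i ∈ s \ t, τ) *
        ‖expMulBlaschke (fun u => (σ : ℂ) * H u) t a z‖ ^ q =
      Real.exp (σ * q * (H z).re) * ∏ i ∈ s, (σ * ‖mob (a i) z‖ ^ q + τ) := by
    rw [Finset.prod_add, Finset.mul_sum]
    refine Finset.sum_congr rfl fun t _ => ?_
    rw [norm_expMulBlaschke_rpow, Complex.re_ofReal_mul, Finset.prod_mul_distrib,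
      show q * (σ * (H z).re) = σ * q * (H z).re by ring]
    ring
  rw [h1, mul_sub, sub_eq_add_neg, Real.exp_add, Finset.mul_sum, ← Finset.sum_neg_distrib,
    Real.exp_sum]
  gcongr with i _
  have h2 := Real.add_one_le_exp (-(σ * q * ((1 - ‖mob (a i) z‖ ^ q) / q)))
  refine le_trans (le_of_eq ?_) h2
  field_simp
  linear_combination hστ

lemma sum_powerset_lintegral_le {ι : Type} [DecidableEq ι] {W : ℂ → ℝ} (hW : IsWeight W)
    {σ τ q : ℝ} (hσ : 0 < σ) (hτ : 0 < τ)
    (hστ : σ + τ = 1) (hq : 0 < q) (s : Finset ι) (a : ι → ℂ) (ha : ∀ i, a i ∈ unitDisc)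
    {H : ℂ → ℂ} (hH : DifferentiableOn ℂ H unitDisc) :
    ∑ t ∈ s.powerset, ENNReal.ofReal ((∏ _i ∈ t, σ) * ∏ _i ∈ s \ t, τ) *
        ∫⁻ z in unitDisc, ENNReal.ofReal
          (‖expMulBlaschke (fun u => (σ : ℂ) * H u) t a z‖ ^ q * W z) ≤
      ∫⁻ z in unitDisc, ENNReal.ofReal
        (Real.exp (σ * q * ((H z).re - ∑ i ∈ s, (1 - ‖mob (a i) z‖ ^ q) / q)) * W z) := by
  have hm : ∀ t : Finset ι, AEMeasurable (fun z => ENNReal.ofReal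
      ((∏ _i ∈ t, σ) * ∏ _i ∈ s \ t, τ) * ENNReal.ofReal
        (‖expMulBlaschke (fun u => (σ : ℂ) * H u) t a z‖ ^ q * W z))
      (volume.restrict unitDisc) := fun t =>
    ((aemeasurable_norm_rpow_mul hW.2 (differentiableOn_expMulBlaschke (hH.const_mul _) ha)
      q).ennreal_ofReal).const_mul _
  calc _ = ∫⁻ z in unitDisc, ∑ t ∈ s.powerset,
          ENNReal.ofReal ((∏ _i ∈ t, σ) * ∏ _i ∈ s \ t, τ) *
            ENNReal.ofReal (‖expMulBlaschke (fun u => (σ : ℂ) * H u) t a z‖ ^ q * W z) := by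
        rw [lintegral_finsetSum' _ fun t _ => hm t]
        exact Finset.sum_congr rfl fun t _ => (lintegral_const_mul' _ _ ENNReal.ofReal_ne_top).symm
    _ ≤ _ := by
        refine setLIntegral_mono' measurableSet_unitDisc fun z hz => ?_
        have hWz := hW.1 z hz
        have hw : ∀ t : Finset ι, 0 ≤ (∏ _i ∈ t, σ) * ∏ _i ∈ s \ t, τ := fun t => by positivity
        rw [Finset.sum_congr rfl fun t _ => (ENNReal.ofReal_mul (hw t)).symm,
          ← ENNReal.ofReal_sum_of_nonneg fun t _ => by have := hw t; positivity]
        refine ENNReal.ofReal_le_ofReal ?_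
        rw [Finset.sum_congr rfl fun t _ => (mul_assoc _ _ _).symm, ← Finset.sum_mul]
        exact mul_le_mul_of_nonneg_right (sum_powerset_rpow_le hσ hτ hστ hq s a H z) hWz.le

lemma exists_le_of_sum_ofReal_mul_le {κ : Type} {s : Finset κ} {w : κ → ℝ} {I : κ → ENNReal}
    {X : ENNReal} (hw : ∀ t ∈ s, 0 < w t) (hw1 : ∑ t ∈ s, w t = 1)
    (h : ∑ t ∈ s, ENNReal.ofReal (w t) * I t ≤ X) : ∃ t ∈ s, I t ≤ X := by
  by_contra! hI
  have hne : s.Nonempty := by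
    rw [Finset.nonempty_iff_ne_empty]
    rintro rfl
    simp at hw1
  have hX : X ≠ ⊤ := by
    obtain ⟨t, ht⟩ := hne
    exact (hI t ht).ne_top
  have h1 : ∑ t ∈ s, ENNReal.ofReal (w t) * X < ∑ t ∈ s, ENNReal.ofReal (w t) * I t := by
    refine ENNReal.sum_lt_sum_of_nonempty hne fun t ht => ?_
    exact ENNReal.mul_lt_mul_right (ENNReal.ofReal_pos.mpr (hw t ht)).ne' ENNReal.ofReal_ne_top
      (hI t ht)
  rw [← Finset.sum_mul, ← ENNReal.ofReal_sum_of_nonneg fun t ht => (hw t ht).le, hw1,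
    ENNReal.ofReal_one, one_mul] at h1
  exact (h1.trans_le h).false

lemma exists_split_expMulBlaschke {W : ℂ → ℝ} (hW : IsWeight W) (hinv : IsInvariantWeight W)
    {p p₁ p₂ s₁ s₂ : ℝ} (hp : 0 < p) (hp₁ : 0 < p₁) (hp₂ : 0 < p₂) (hs₁ : 0 < s₁) (hs₂ : 0 < s₂)
    (hs : s₁ + s₂ = 1) (h₁ : s₁ * p₁ = p) (h₂ : s₂ * p₂ = p) :
    ∃ C : ℝ, 0 < C ∧ ∀ {ι : Type} [DecidableEq ι] (s : Finset ι) (a : ι → ℂ),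
      (∀ i, a i ∈ unitDisc) →
      ∀ (H : ℂ → ℂ), DifferentiableOn ℂ H unitDisc → ∀ M : ℝ, (∀ w ∈ unitDisc, (H w).re ≤ M) →
      ∃ t ⊆ s, ENNReal.ofReal s₁ * (∫⁻ z in unitDisc, ENNReal.ofReal
          (‖expMulBlaschke (fun u => (s₁ : ℂ) * H u) t a z‖ ^ p₁ * W z)) +
        ENNReal.ofReal s₂ * (∫⁻ z in unitDisc, ENNReal.ofReal
          (‖expMulBlaschke (fun u => (s₂ : ℂ) * H u) (s \ t) a z‖ ^ p₂ * W z)) ≤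
        ENNReal.ofReal C *
          ∫⁻ z in unitDisc, ENNReal.ofReal (‖expMulBlaschke H s a z‖ ^ p * W z) := by
  obtain ⟨C₁, hC₁, k₁⟩ := exists_lintegral_exp_le hW hinv hp₁
  obtain ⟨C₂, hC₂, k₂⟩ := exists_lintegral_exp_le hW hinv hp₂
  refine ⟨s₁ * C₁ + s₂ * C₂, by positivity, fun s a ha H hH M hM => ?_⟩
  set X := ∫⁻ z in unitDisc, ENNReal.ofReal (‖expMulBlaschke H s a z‖ ^ p * W z) with hX
  set I₁ := fun t => ∫⁻ z in unitDisc, ENNReal.ofReal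
          (‖expMulBlaschke (fun u => (s₁ : ℂ) * H u) t a z‖ ^ p₁ * W z) with hI₁
  set I₂ := fun t => ∫⁻ z in unitDisc, ENNReal.ofReal
          (‖expMulBlaschke (fun u => (s₂ : ℂ) * H u) t a z‖ ^ p₂ * W z) with hI₂
  have b₁ : ∑ t ∈ s.powerset, ENNReal.ofReal ((∏ _i ∈ t, s₁) * ∏ _i ∈ s \ t, s₂) * I₁ t ≤
      ENNReal.ofReal C₁ * X := by
    refine (sum_powerset_lintegral_le hW hs₁ hs₂ hs hp₁ s a ha hH).trans ?_
    rw [h₁]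
    exact k₁ s a ha H hH M hM p hp
  have b₂ : ∑ t ∈ s.powerset, ENNReal.ofReal ((∏ _i ∈ t, s₁) * ∏ _i ∈ s \ t, s₂) * I₂ (s \ t) ≤
      ENNReal.ofReal C₂ * X := by
    have h3 : ∑ t ∈ s.powerset, ENNReal.ofReal ((∏ _i ∈ t, s₁) * ∏ _i ∈ s \ t, s₂) * I₂ (s \ t) =
        ∑ t ∈ s.powerset, ENNReal.ofReal ((∏ _i ∈ t, s₂) * ∏ _i ∈ s \ t, s₁) * I₂ t := by
      refine Finset.sum_nbij' (s \ ·) (s \ ·) (by simp) (by simp)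
        (fun t ht => ?_) (fun t ht => ?_) (fun t ht => ?_)
      · exact Finset.sdiff_sdiff_eq_self (Finset.mem_powerset.mp ht)
      · exact Finset.sdiff_sdiff_eq_self (Finset.mem_powerset.mp ht)
      · simp only [Finset.sdiff_sdiff_eq_self (Finset.mem_powerset.mp ht), mul_comm]
    rw [h3]
    refine (sum_powerset_lintegral_le hW hs₂ hs₁ (by rw [add_comm, hs]) hp₂ s a ha hH).trans ?_
    rw [h₂]
    exact k₂ s a ha H hH M hM p hp
  have hsum : ∑ t ∈ s.powerset, ENNReal.ofReal ((∏ _i ∈ t, s₁) * ∏ _i ∈ s \ t, s₂) *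
      (ENNReal.ofReal s₁ * I₁ t + ENNReal.ofReal s₂ * I₂ (s \ t)) ≤
      ENNReal.ofReal (s₁ * C₁ + s₂ * C₂) * X := by
    calc _ = ENNReal.ofReal s₁ * (∑ t ∈ s.powerset,
            ENNReal.ofReal ((∏ _i ∈ t, s₁) * ∏ _i ∈ s \ t, s₂) * I₁ t) +
          ENNReal.ofReal s₂ * ∑ t ∈ s.powerset,
            ENNReal.ofReal ((∏ _i ∈ t, s₁) * ∏ _i ∈ s \ t, s₂) * I₂ (s \ t) := by
          rw [Finset.mul_sum, Finset.mul_sum, ← Finset.sum_add_distrib]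
          exact Finset.sum_congr rfl fun t _ => by ring
      _ ≤ ENNReal.ofReal s₁ * (ENNReal.ofReal C₁ * X) +
          ENNReal.ofReal s₂ * (ENNReal.ofReal C₂ * X) := by gcongr
      _ = _ := by
          rw [ENNReal.ofReal_add (by positivity) (by positivity), ENNReal.ofReal_mul hs₁.le,
            ENNReal.ofReal_mul hs₂.le]
          ring
  obtain ⟨t, ht, h⟩ := exists_le_of_sum_ofReal_mul_le (fun t _ => by positivity)
    (by rw [← Finset.prod_add]; simp [hs]) hsum
  exact ⟨t, Finset.mem_powerset.mp ht, h⟩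

lemma expMulBlaschke_eq_mul {ι : Type} [DecidableEq ι] {s₁ s₂ : ℝ} (hs : s₁ + s₂ = 1)
    {s t : Finset ι} (ht : t ⊆ s) (a : ι → ℂ) (H : ℂ → ℂ) (z : ℂ) :
    expMulBlaschke H s a z = expMulBlaschke (fun u => (s₁ : ℂ) * H u) t a z *
      expMulBlaschke (fun u => (s₂ : ℂ) * H u) (s \ t) a z := by
  simp only [expMulBlaschke]
  rw [mul_mul_mul_comm, ← Complex.exp_add, ← add_mul, ← Complex.ofReal_add, hs,
    mul_comm (∏ i ∈ t, _), Finset.prod_sdiff ht]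
  simp

lemma exists_polynomial_factorization {W : ℂ → ℝ} (hW : IsWeight W) (hinv : IsInvariantWeight W)
    {p p₁ p₂ s₁ s₂ : ℝ} (hp : 0 < p) (hp₁ : 0 < p₁) (hp₂ : 0 < p₂) (hs₁ : 0 < s₁) (hs₂ : 0 < s₂)
    (hs : s₁ + s₂ = 1) (h₁ : s₁ * p₁ = p) (h₂ : s₂ * p₂ = p) :
    ∃ (C : ℝ) (D : ℝ → ℝ), 0 < C ∧ ∀ P : Polynomial ℂ, ∃ g₁ g₂ : ℂ → ℂ,
      DifferentiableOn ℂ g₁ unitDisc ∧ DifferentiableOn ℂ g₂ unitDisc ∧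
      (∀ z ∈ unitDisc, P.eval z = g₁ z * g₂ z) ∧
      ENNReal.ofReal s₁ * (∫⁻ z in unitDisc, ENNReal.ofReal (‖g₁ z‖ ^ p₁ * W z)) +
        ENNReal.ofReal s₂ * (∫⁻ z in unitDisc, ENNReal.ofReal (‖g₂ z‖ ^ p₂ * W z)) ≤
        ENNReal.ofReal C * ∫⁻ z in unitDisc, ENNReal.ofReal (‖P.eval z‖ ^ p * W z) ∧
      (∀ ρ < 1, ∀ z : ℂ, ‖z‖ ≤ ρ → ENNReal.ofReal (‖g₁ z‖ ^ p₁) ≤ ENNReal.ofReal (D ρ) *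
        ∫⁻ u in unitDisc, ENNReal.ofReal (‖g₁ u‖ ^ p₁ * W u)) ∧
      (∀ ρ < 1, ∀ z : ℂ, ‖z‖ ≤ ρ → ENNReal.ofReal (‖g₂ z‖ ^ p₂) ≤ ENNReal.ofReal (D ρ) *
        ∫⁻ u in unitDisc, ENNReal.ofReal (‖g₂ u‖ ^ p₂ * W u)) := by
  classical
  obtain ⟨C, hC, hsplit⟩ := exists_split_expMulBlaschke hW hinv hp hp₁ hp₂ hs₁ hs₂ hs h₁ h₂
  obtain ⟨D, -, hloc⟩ := exists_local_bound hW hinv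
  refine ⟨C, D, hC, fun P => ?_⟩
  by_cases hP : P = 0
  · refine ⟨fun _ => 0, fun _ => 0, differentiableOn_const _, differentiableOn_const _, ?_⟩
    simp [hP, Real.zero_rpow hp₁.ne', Real.zero_rpow hp₂.ne']
  obtain ⟨n, a, H, M, ha, hH, hM, hrep⟩ := hasExpBlaschke_eval hP
  obtain ⟨t, ht, hle⟩ := hsplit Finset.univ a ha H hH M hM
  have hb : ∀ σ : ℝ, 0 < σ → ∀ w ∈ unitDisc, ((σ : ℂ) * H w).re ≤ σ * M := fun σ hσ w hw => by
    rw [Complex.re_ofReal_mul]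
    exact mul_le_mul_of_nonneg_left (hM w hw) hσ.le
  refine ⟨expMulBlaschke (fun u => (s₁ : ℂ) * H u) t a,
    expMulBlaschke (fun u => (s₂ : ℂ) * H u) (Finset.univ \ t) a,
    differentiableOn_expMulBlaschke (hH.const_mul _) ha,
    differentiableOn_expMulBlaschke (hH.const_mul _) ha,
    fun z hz => (hrep z hz).trans (expMulBlaschke_eq_mul hs ht a H z), ?_,
    hloc t a ha _ (hH.const_mul _) _ (hb s₁ hs₁) p₁ hp₁,
    hloc _ a ha _ (hH.const_mul _) _ (hb s₂ hs₂) p₂ hp₂⟩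
  rwa [setLIntegral_congr_fun (f := fun z => ENNReal.ofReal (‖P.eval z‖ ^ p * W z))
    (g := fun z => ENNReal.ofReal (‖expMulBlaschke H Finset.univ a z‖ ^ p * W z))
    measurableSet_unitDisc fun z hz => by simp only [← hrep z hz]]

/-- The `k`-th Taylor coefficient at the origin. -/
def taylorCoeffZero (f : ℂ → ℂ) (k : ℕ) : ℂ := (k.factorial : ℂ)⁻¹ * iteratedDeriv k f 0

lemma hasSum_taylorCoeffZero {f : ℂ → ℂ} (hf : DifferentiableOn ℂ f unitDisc) {z : ℂ}
    (hz : z ∈ unitDisc) : HasSum (fun k => taylorCoeffZero f k * z ^ k) (f z) := by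
  rw [unitDisc_eq_ball] at hf hz
  refine (Complex.hasSum_taylorSeries_on_ball hf hz).congr_fun ?_
  intro k
  simp only [taylorCoeffZero, smul_eq_mul, sub_zero]
  ring

lemma norm_taylorCoeffZero_le {f : ℂ → ℂ} (hf : DifferentiableOn ℂ f unitDisc) {ρ M : ℝ}
    (hρ : 0 < ρ) (hρ1 : ρ < 1) (hM : ∀ z, ‖z‖ ≤ ρ → ‖f z‖ ≤ M) (k : ℕ) :
    ‖taylorCoeffZero f k‖ ≤ M / ρ ^ k := by
  have hd : DiffContOnCl ℂ f (Metric.ball 0 ρ) := by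
    refine DifferentiableOn.diffContOnCl (hf.mono ?_)
    refine Metric.closure_ball_subset_closedBall.trans fun w hw => ?_
    exact (mem_closedBall_zero_iff.mp hw).trans_lt hρ1
  have h := Complex.norm_iteratedDeriv_le_of_forall_mem_sphere_norm_le k hρ hd
    (fun z hz => hM z (mem_sphere_zero_iff_norm.mp hz).le)
  have hk : (0 : ℝ) < k.factorial := by exact_mod_cast k.factorial_pos
  rw [taylorCoeffZero, norm_mul, norm_inv, Complex.norm_natCast, inv_mul_le_iff₀ hk]
  refine h.trans (le_of_eq ?_)
  ring

lemma exists_subseq_tendsto_of_locally_bounded {g : ℕ → ℂ → ℂ}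
    (hg : ∀ n, DifferentiableOn ℂ (g n) unitDisc)
    (hb : ∀ ρ < 1, ∃ M : ℝ, ∀ n, ∀ z, ‖z‖ ≤ ρ → ‖g n z‖ ≤ M) :
    ∃ (φ : ℕ → ℕ) (G : ℂ → ℂ), StrictMono φ ∧ DifferentiableOn ℂ G unitDisc ∧
      ∀ z ∈ unitDisc, Tendsto (fun n => g (φ n) z) atTop (nhds (G z)) := by
  choose! M hM using hb
  have hc : ∀ ρ, 0 < ρ → ρ < 1 → ∀ n k, ‖taylorCoeffZero (g n) k‖ ≤ M ρ / ρ ^ k :=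
    fun ρ h0 h1 n k => norm_taylorCoeffZero_le (hg n) h0 h1 (hM ρ h1 n) k
  have hcomp : IsCompact (Set.pi univ fun k : ℕ =>
      Metric.closedBall (0 : ℂ) (M (1 / 2) / (1 / 2) ^ k)) :=
    isCompact_univ_pi fun k => isCompact_closedBall _ _
  obtain ⟨c, -, φ, hφ, hlim⟩ := hcomp.tendsto_subseq (x := fun n => taylorCoeffZero (g n))
    fun n k _ => mem_closedBall_zero_iff.mpr (hc _ (by norm_num) (by norm_num) n k)
  have hlim' : ∀ k, Tendsto (fun n => taylorCoeffZero (g (φ n)) k) atTop (nhds (c k)) :=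
    fun k => (tendsto_pi_nhds.mp hlim) k
  have hcc : ∀ ρ, 0 < ρ → ρ < 1 → ∀ k, ‖c k‖ ≤ M ρ / ρ ^ k := fun ρ h0 h1 k =>
    le_of_tendsto (hlim' k).norm (Eventually.of_forall fun n => hc ρ h0 h1 (φ n) k)
  have hsum : ∀ x ρ : ℝ, 0 ≤ x → x < ρ → Summable fun k : ℕ => M ρ / ρ ^ k * x ^ k :=
    fun x ρ h0 h1 => by
    have hρ : 0 < ρ := h0.trans_lt h1
    refine ((summable_geometric_of_lt_one (div_nonneg h0 hρ.le)
      ((div_lt_one hρ).mpr h1)).mul_left (M ρ)).congr fun k => ?_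
    rw [div_pow]
    ring
  have hbd : ∀ (d : ℂ) (x ρ : ℝ) (k : ℕ) (w : ℂ), ‖w‖ ≤ x → ‖d‖ ≤ M ρ / ρ ^ k →
      ‖d * w ^ k‖ ≤ M ρ / ρ ^ k * x ^ k := fun d x ρ k w hw hd => by
    rw [norm_mul, norm_pow]
    have := (norm_nonneg d).trans hd
    gcongr
  refine ⟨φ, fun z => ∑' k, c k * z ^ k, hφ, fun z hz => ?_, fun z hz => ?_⟩
  · have hz1 : ‖z‖ < 1 := hz
    obtain ⟨x, hx, hx1⟩ := exists_between hz1
    obtain ⟨ρ, hρ, hρ1⟩ := exists_between hx1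
    have hx0 : 0 < x := (norm_nonneg z).trans_lt hx
    have hd : DifferentiableOn ℂ (fun z => ∑' k, c k * z ^ k) (Metric.ball 0 x) :=
      Complex.differentiableOn_tsum_of_summable_norm (hsum x ρ hx0.le hρ)
        (fun k => by fun_prop) Metric.isOpen_ball
        fun k w hw => hbd _ x ρ k w (mem_ball_zero_iff.mp hw).le
          (hcc ρ (hx0.trans hρ) hρ1 k)
    exact (hd.differentiableAt (Metric.isOpen_ball.mem_nhds
      (mem_ball_zero_iff.mpr hx))).differentiableWithinAt
  · have hz1 : ‖z‖ < 1 := hz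
    obtain ⟨ρ, hρ, hρ1⟩ := exists_between hz1
    have h := tendsto_tsum_of_dominated_convergence (𝓕 := atTop)
      (f := fun n k => taylorCoeffZero (g (φ n)) k * z ^ k) (g := fun k => c k * z ^ k)
      (hsum ‖z‖ ρ (norm_nonneg z) hρ)
      (fun k => (hlim' k).mul_const _)
      (Eventually.of_forall fun n k => hbd _ ‖z‖ ρ k z le_rfl
        (hc ρ ((norm_nonneg z).trans_lt hρ) hρ1 (φ n) k))
    simpa only [(hasSum_taylorCoeffZero (hg _) hz).tsum_eq] using h

lemma norm_rpow_le_of_eq_add {x y z : ℂ} (h : x = y + z) {p : ℝ} (hp : 0 < p) :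
    ‖x‖ ^ p ≤ 2 ^ p * (‖y‖ ^ p + ‖z‖ ^ p) := by
  have h1 : ‖x‖ ≤ 2 * max ‖y‖ ‖z‖ := by
    rw [h]
    linarith [norm_add_le y z, le_max_left ‖y‖ ‖z‖, le_max_right ‖y‖ ‖z‖]
  have h2 : (max ‖y‖ ‖z‖) ^ p ≤ ‖y‖ ^ p + ‖z‖ ^ p := by
    have hy := Real.rpow_nonneg (norm_nonneg y) p
    have hz := Real.rpow_nonneg (norm_nonneg z) p
    rcases max_choice ‖y‖ ‖z‖ with h | h <;> rw [h] <;> linarith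
  calc ‖x‖ ^ p ≤ (2 * max ‖y‖ ‖z‖) ^ p := by gcongr
    _ = 2 ^ p * (max ‖y‖ ‖z‖) ^ p :=
        Real.mul_rpow zero_le_two ((norm_nonneg y).trans (le_max_left _ _))
    _ ≤ _ := by gcongr

lemma integrableOn_of_lintegral_lt_top {W : ℂ → ℝ} (hW : IsWeight W) {f : ℂ → ℂ}
    (hf : DifferentiableOn ℂ f unitDisc) {p : ℝ}
    (h : ∫⁻ z in unitDisc, ENNReal.ofReal (‖f z‖ ^ p * W z) < ⊤) :
    IntegrableOn (fun z => ‖f z‖ ^ p * W z) unitDisc := by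
  refine ⟨(aemeasurable_norm_rpow_mul hW.2 hf p).aestronglyMeasurable, ?_⟩
  rwa [hasFiniteIntegral_iff_ofReal]
  filter_upwards [ae_restrict_mem measurableSet_unitDisc] with z hz
  have := hW.1 z hz
  positivity

lemma integral_eq_toReal_lintegral {W : ℂ → ℝ} (hW : IsWeight W) {f : ℂ → ℂ}
    (hf : DifferentiableOn ℂ f unitDisc) (p : ℝ) :
    ∫ z in unitDisc, ‖f z‖ ^ p * W z =
      (∫⁻ z in unitDisc, ENNReal.ofReal (‖f z‖ ^ p * W z)).toReal := by
  refine integral_eq_lintegral_of_nonneg_ae ?_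
    (aemeasurable_norm_rpow_mul hW.2 hf p).aestronglyMeasurable
  filter_upwards [ae_restrict_mem measurableSet_unitDisc] with z hz
  have := hW.1 z hz
  positivity

lemma lintegral_lt_top_of_integrableOn {W : ℂ → ℝ} {f : ℂ → ℂ} {p : ℝ}
    (h : IntegrableOn (fun z => ‖f z‖ ^ p * W z) unitDisc) :
    ∫⁻ z in unitDisc, ENNReal.ofReal (‖f z‖ ^ p * W z) < ⊤ :=
  (lintegral_mono fun _ => Real.ofReal_le_enorm _).trans_lt h.2

lemma lintegral_rpow_le_of_eq_add {W : ℂ → ℝ} (hW : IsWeight W) {f g h : ℂ → ℂ}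
    (hg : DifferentiableOn ℂ g unitDisc) (hfgh : ∀ z, f z = g z + h z) {p : ℝ} (hp : 0 < p) :
    ∫⁻ z in unitDisc, ENNReal.ofReal (‖f z‖ ^ p * W z) ≤ ENNReal.ofReal (2 ^ p) *
      ((∫⁻ z in unitDisc, ENNReal.ofReal (‖g z‖ ^ p * W z)) +
        ∫⁻ z in unitDisc, ENNReal.ofReal (‖h z‖ ^ p * W z)) := by
  rw [← lintegral_add_left' (aemeasurable_norm_rpow_mul hW.2 hg p).ennreal_ofReal,
    ← lintegral_const_mul' _ _ ENNReal.ofReal_ne_top]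
  refine setLIntegral_mono' measurableSet_unitDisc fun z hz => ?_
  have hWz := hW.1 z hz
  rw [← ENNReal.ofReal_add (by positivity) (by positivity), ← ENNReal.ofReal_mul (by positivity),
    ← add_mul, ← mul_assoc]
  exact ENNReal.ofReal_le_ofReal
    (mul_le_mul_of_nonneg_right (norm_rpow_le_of_eq_add (hfgh z) hp) hWz.le)

lemma lintegral_polynomial_lt_top {W : ℂ → ℝ} (hW : IsWeight W) (P : Polynomial ℂ) {p : ℝ}
    (hp : 0 < p) : ∫⁻ z in unitDisc, ENNReal.ofReal (‖P.eval z‖ ^ p * W z) < ⊤ := by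
  obtain ⟨B, hB⟩ := (isCompact_closedBall (0 : ℂ) 1).exists_bound_of_continuousOn
    (f := fun z => P.eval z) P.continuous.continuousOn
  have hWi : ∫⁻ z in unitDisc, ENNReal.ofReal (W z) < ⊤ :=
    (lintegral_mono fun _ => Real.ofReal_le_enorm _).trans_lt hW.2.2
  calc ∫⁻ z in unitDisc, ENNReal.ofReal (‖P.eval z‖ ^ p * W z)
      ≤ ∫⁻ z in unitDisc, ENNReal.ofReal (B ^ p) * ENNReal.ofReal (W z) := by
        refine setLIntegral_mono' measurableSet_unitDisc fun z hz => ?_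
        have hz1 : ‖z‖ < 1 := hz
        have hWz := hW.1 z hz
        have hBz := hB z (mem_closedBall_zero_iff.mpr hz1.le)
        have hB0 := (norm_nonneg _).trans hBz
        rw [← ENNReal.ofReal_mul (by positivity)]
        refine ENNReal.ofReal_le_ofReal ?_
        gcongr
    _ = ENNReal.ofReal (B ^ p) * ∫⁻ z in unitDisc, ENNReal.ofReal (W z) :=
        lintegral_const_mul' _ _ ENNReal.ofReal_ne_top
    _ < ⊤ := ENNReal.mul_lt_top ENNReal.ofReal_lt_top hWi

lemma PolyDense.exists_approx {W : ℂ → ℝ} (hW : IsWeight W) {p : ℝ} (hp : 0 < p)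
    (hdense : PolyDense p W) {f : ℂ → ℂ} (hf : DifferentiableOn ℂ f unitDisc)
    (hfi : IntegrableOn (fun z => ‖f z‖ ^ p * W z) unitDisc) {ε : ℝ} (hε : 0 < ε) :
    ∃ P : Polynomial ℂ,
      ∫⁻ z in unitDisc, ENNReal.ofReal (‖f z - P.eval z‖ ^ p * W z) ≤ ENNReal.ofReal ε := by
  obtain ⟨P, hP⟩ := hdense f hf hfi ε hε
  refine ⟨P, ?_⟩
  rw [integral_eq_toReal_lintegral hW (f := fun z => f z - P.eval z)
    (hf.sub P.differentiable.differentiableOn)] at hP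
  have hfin : ∫⁻ z in unitDisc, ENNReal.ofReal (‖f z - P.eval z‖ ^ p * W z) ≠ ⊤ := by
    refine ((lintegral_rpow_le_of_eq_add hW (g := f) (h := fun z => -P.eval z) hf
      (fun z => sub_eq_add_neg _ _) hp).trans_lt ?_).ne
    simp only [norm_neg]
    exact ENNReal.mul_lt_top ENNReal.ofReal_lt_top
      (ENNReal.add_lt_top.mpr ⟨lintegral_lt_top_of_integrableOn hfi,
        lintegral_polynomial_lt_top hW P hp⟩)
  exact (ENNReal.le_ofReal_iff_toReal_le hfin hε.le).mpr hP.le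

lemma ae_tendsto_of_lintegral_le {W : ℂ → ℝ} (hW : IsWeight W) {p : ℝ} (hp : 0 < p) {f : ℂ → ℂ}
    (hf : DifferentiableOn ℂ f unitDisc) {P : ℕ → ℂ → ℂ}
    (hP : ∀ n, DifferentiableOn ℂ (P n) unitDisc)
    (h : ∀ n, ∫⁻ z in unitDisc, ENNReal.ofReal (‖f z - P n z‖ ^ p * W z) ≤
      ENNReal.ofReal ((1 / 2) ^ n)) :
    ∀ᵐ z ∂volume.restrict unitDisc, Tendsto (fun n => P n z) atTop (nhds (f z)) := by
  have hm : ∀ n, AEMeasurable (fun z => ENNReal.ofReal (‖f z - P n z‖ ^ p * W z))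
      (volume.restrict unitDisc) := fun n =>
    (aemeasurable_norm_rpow_mul (f := fun z => f z - P n z) hW.2 (hf.sub (hP n)) p).ennreal_ofReal
  have hsum : ∫⁻ z in unitDisc, ∑' n, ENNReal.ofReal (‖f z - P n z‖ ^ p * W z) ≠ ⊤ := by
    rw [lintegral_tsum hm]
    refine ((ENNReal.tsum_le_tsum h).trans_lt ?_).ne
    rw [← ENNReal.ofReal_tsum_of_nonneg (fun n => by positivity) summable_geometric_two]
    exact ENNReal.ofReal_lt_top
  filter_upwards [ae_lt_top' (AEMeasurable.tsum hm) hsum,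
    ae_restrict_mem measurableSet_unitDisc] with z hz hzD
  have hWz := hW.1 z hzD
  have h0 := (ENNReal.tendsto_toReal ENNReal.zero_ne_top).comp
    (ENNReal.tendsto_atTop_zero_of_tsum_ne_top hz.ne)
  have h1 : Tendsto (fun n => ‖f z - P n z‖ ^ p * W z) atTop (nhds 0) := by
    refine h0.congr fun n => ?_
    exact ENNReal.toReal_ofReal (by positivity)
  have h2 : Tendsto (fun n => ‖f z - P n z‖ ^ p) atTop (nhds 0) := by
    have := h1.mul_const (W z)⁻¹
    rw [zero_mul] at this
    exact this.congr fun n => mul_inv_cancel_right₀ hWz.ne' _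
  have h3 : Tendsto (fun n => ‖f z - P n z‖) atTop (nhds 0) := by
    have := h2.rpow_const (p := p⁻¹) (Or.inr (by positivity))
    rw [Real.zero_rpow (inv_ne_zero hp.ne')] at this
    exact this.congr fun n => Real.rpow_rpow_inv (norm_nonneg _) hp.ne'
  rw [tendsto_iff_norm_sub_tendsto_zero]
  exact h3.congr fun n => norm_sub_rev _ _

lemma exists_norm_bound_of_ofReal_rpow_le {D : ℝ → ℝ} {g : ℕ → ℂ → ℂ} {p : ℝ} (hp : 0 < p)
    {I : ℕ → ENNReal} {B : ENNReal} (hB : B ≠ ⊤) (hI : ∀ n, I n ≤ B)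
    (h : ∀ n, ∀ ρ < 1, ∀ z : ℂ, ‖z‖ ≤ ρ →
      ENNReal.ofReal (‖g n z‖ ^ p) ≤ ENNReal.ofReal (D ρ) * I n) :
    ∀ ρ < 1, ∃ M : ℝ, ∀ n, ∀ z, ‖z‖ ≤ ρ → ‖g n z‖ ≤ M := by
  intro ρ hρ
  refine ⟨(ENNReal.ofReal (D ρ) * B).toReal ^ p⁻¹, fun n z hz => ?_⟩
  have h1 := (h n ρ hρ z hz).trans (mul_le_mul_right (hI n) _)
  rw [ENNReal.ofReal_le_iff_le_toReal (ENNReal.mul_ne_top ENNReal.ofReal_ne_top hB)] at h1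
  rw [← Real.rpow_rpow_inv (norm_nonneg (g n z)) hp.ne']
  gcongr

lemma exists_factorization {W : ℂ → ℝ} (hW : IsWeight W) (hinv : IsInvariantWeight W)
    {p p₁ p₂ s₁ s₂ : ℝ} (hp : 0 < p) (hdense : PolyDense p W) (hp₁ : 0 < p₁) (hp₂ : 0 < p₂)
    (hs₁ : 0 < s₁) (hs₂ : 0 < s₂) (hs : s₁ + s₂ = 1) (h₁ : s₁ * p₁ = p) (h₂ : s₂ * p₂ = p) :
    ∃ C : ℝ, 0 < C ∧ ∀ f : ℂ → ℂ, DifferentiableOn ℂ f unitDisc →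
      IntegrableOn (fun z => ‖f z‖ ^ p * W z) unitDisc →
      ∃ f₁ f₂ : ℂ → ℂ, DifferentiableOn ℂ f₁ unitDisc ∧ DifferentiableOn ℂ f₂ unitDisc ∧
        (∀ z ∈ unitDisc, f z = f₁ z * f₂ z) ∧
        ENNReal.ofReal s₁ * (∫⁻ z in unitDisc, ENNReal.ofReal (‖f₁ z‖ ^ p₁ * W z)) +
          ENNReal.ofReal s₂ * (∫⁻ z in unitDisc, ENNReal.ofReal (‖f₂ z‖ ^ p₂ * W z)) ≤
        ENNReal.ofReal C * ∫⁻ z in unitDisc, ENNReal.ofReal (‖f z‖ ^ p * W z) := by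
  obtain ⟨C, D, hC, hpoly⟩ :=
    exists_polynomial_factorization hW hinv hp hp₁ hp₂ hs₁ hs₂ hs h₁ h₂
  refine ⟨C * 2 ^ p, by positivity, fun f hf hfi => ?_⟩
  choose P hP using fun n : ℕ => hdense.exists_approx hW hp hf hfi
    (ε := (1 / 2) ^ n) (by positivity)
  choose g₁ g₂ hg₁ hg₂ hPg hle hloc₁ hloc₂ using fun n => hpoly (P n)
  set X := ∫⁻ z in unitDisc, ENNReal.ofReal (‖f z‖ ^ p * W z) with hX
  have hXtop : X < ⊤ := lintegral_lt_top_of_integrableOn hfi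
  set I₁ := fun n => ∫⁻ z in unitDisc, ENNReal.ofReal (‖g₁ n z‖ ^ p₁ * W z) with hI₁
  set I₂ := fun n => ∫⁻ z in unitDisc, ENNReal.ofReal (‖g₂ n z‖ ^ p₂ * W z) with hI₂
  set R : ℕ → ENNReal := fun n =>
    ENNReal.ofReal (C * 2 ^ p) * (X + ENNReal.ofReal ((1 / 2) ^ n)) with hR
  have hbound : ∀ n, ENNReal.ofReal s₁ * I₁ n + ENNReal.ofReal s₂ * I₂ n ≤ R n := fun n => by
    refine (hle n).trans ?_
    rw [hR]
    simp only []
    rw [ENNReal.ofReal_mul hC.le, mul_assoc]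
    gcongr
    have hadd := lintegral_rpow_le_of_eq_add hW (f := fun z => (P n).eval z) (g := f)
      (h := fun z => -(f z - (P n).eval z)) hf (fun z => by ring) hp
    simp only [norm_neg] at hadd
    exact hadd.trans (mul_le_mul_right (add_le_add_right (hP n) _) _)
  set B := ENNReal.ofReal (C * 2 ^ p) * (X + 1) with hB
  have hBtop : B ≠ ⊤ := (ENNReal.mul_lt_top ENNReal.ofReal_lt_top
    (ENNReal.add_lt_top.mpr ⟨hXtop, ENNReal.one_lt_top⟩)).ne
  have hRB : ∀ n, R n ≤ B := fun n => by
    have h1 : ENNReal.ofReal ((1 / 2) ^ n) ≤ 1 := by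
      rw [← ENNReal.ofReal_one]
      exact ENNReal.ofReal_le_ofReal (pow_le_one₀ (by norm_num) (by norm_num))
    exact mul_le_mul_right (add_le_add_right h1 _) _
  have hdiv : ∀ s : ℝ, 0 < s → ∀ I : ENNReal, ENNReal.ofReal s * I ≤ B →
      I ≤ B / ENNReal.ofReal s := fun s hs I h => by
    rw [ENNReal.le_div_iff_mul_le (Or.inl (ENNReal.ofReal_pos.mpr hs).ne')
      (Or.inl ENNReal.ofReal_ne_top), mul_comm]
    exact h
  have hdivtop : ∀ s : ℝ, 0 < s → B / ENNReal.ofReal s ≠ ⊤ := fun s hs =>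
    ENNReal.div_ne_top hBtop (ENNReal.ofReal_pos.mpr hs).ne'
  have hb₁ := exists_norm_bound_of_ofReal_rpow_le hp₁ (hdivtop s₁ hs₁)
    (fun n => hdiv s₁ hs₁ (I₁ n) ((le_self_add.trans (hbound n)).trans (hRB n))) hloc₁
  have hb₂ := exists_norm_bound_of_ofReal_rpow_le hp₂ (hdivtop s₂ hs₂)
    (fun n => hdiv s₂ hs₂ (I₂ n) ((le_add_self.trans (hbound n)).trans (hRB n))) hloc₂
  obtain ⟨φ, f₁, hφ, hf₁, hlim₁⟩ := exists_subseq_tendsto_of_locally_bounded hg₁ hb₁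
  obtain ⟨ψ, f₂, hψ, hf₂, hlim₂⟩ := exists_subseq_tendsto_of_locally_bounded
    (g := fun n => g₂ (φ n)) (fun n => hg₂ _)
    (fun ρ hρ => (hb₂ ρ hρ).imp fun M hM n z hz => hM _ z hz)
  have hlim₁' : ∀ z ∈ unitDisc, Tendsto (fun n => g₁ (φ (ψ n)) z) atTop (nhds (f₁ z)) :=
    fun z hz => (hlim₁ z hz).comp hψ.tendsto_atTop
  have hφψ : Tendsto (fun n => φ (ψ n)) atTop atTop := (hφ.comp hψ).tendsto_atTop
  refine ⟨f₁, f₂, hf₁, hf₂, ?_, ?_⟩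
  · have hae : f =ᵐ[volume.restrict unitDisc] fun z => f₁ z * f₂ z := by
      filter_upwards [ae_tendsto_of_lintegral_le hW hp hf
        (fun n => (P n).differentiable.differentiableOn) hP,
        ae_restrict_mem measurableSet_unitDisc] with z hz hzD
      refine tendsto_nhds_unique (hz.comp hφψ) ?_
      exact ((hlim₁' z hzD).mul (hlim₂ z hzD)).congr fun n => (hPg _ z hzD).symm
    exact Measure.eqOn_open_of_ae_eq hae isOpen_unitDisc hf.continuousOn
      (hf₁.mul hf₂).continuousOn
  · set F : (ℂ → ℂ) → (ℂ → ℂ) → ℂ → ENNReal := fun u v z =>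
      ENNReal.ofReal s₁ * ENNReal.ofReal (‖u z‖ ^ p₁ * W z) +
        ENNReal.ofReal s₂ * ENNReal.ofReal (‖v z‖ ^ p₂ * W z) with hF
    have hm : ∀ u : ℂ → ℂ, DifferentiableOn ℂ u unitDisc → ∀ e : ℝ, AEMeasurable
        (fun z => ENNReal.ofReal (‖u z‖ ^ e * W z)) (volume.restrict unitDisc) :=
      fun u hu e => (aemeasurable_norm_rpow_mul hW.2 hu e).ennreal_ofReal
    have hFint : ∀ u v : ℂ → ℂ, DifferentiableOn ℂ u unitDisc →
        ∫⁻ z in unitDisc, F u v z =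
          ENNReal.ofReal s₁ * (∫⁻ z in unitDisc, ENNReal.ofReal (‖u z‖ ^ p₁ * W z)) +
          ENNReal.ofReal s₂ * (∫⁻ z in unitDisc, ENNReal.ofReal (‖v z‖ ^ p₂ * W z)) :=
      fun u v hu => by
        rw [lintegral_add_left' ((hm u hu p₁).const_mul _),
          lintegral_const_mul' _ _ ENNReal.ofReal_ne_top,
          lintegral_const_mul' _ _ ENNReal.ofReal_ne_top]
    have hFlim : ∀ z ∈ unitDisc, Tendsto (fun n => F (g₁ (φ (ψ n))) (g₂ (φ (ψ n))) z) atTop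
        (nhds (F f₁ f₂ z)) := fun z hz => by
      have hterm : ∀ {x : ℕ → ℂ} {y : ℂ} {e s : ℝ}, 0 < e → Tendsto x atTop (nhds y) →
          Tendsto (fun n => ENNReal.ofReal s * ENNReal.ofReal (‖x n‖ ^ e * W z)) atTop
            (nhds (ENNReal.ofReal s * ENNReal.ofReal (‖y‖ ^ e * W z))) := fun he hx =>
        ENNReal.Tendsto.const_mul (ENNReal.tendsto_ofReal
          ((hx.norm.rpow_const (Or.inr he.le)).mul_const _)) (Or.inr ENNReal.ofReal_ne_top)
      exact (hterm hp₁ (hlim₁' z hz)).add (hterm hp₂ (hlim₂ z hz))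
    have hR0 : Tendsto R atTop (nhds (ENNReal.ofReal (C * 2 ^ p) * X)) := by
      have h1 : Tendsto (fun n : ℕ => ENNReal.ofReal ((1 / 2) ^ n)) atTop (nhds 0) := by
        rw [← ENNReal.ofReal_zero]
        exact ENNReal.tendsto_ofReal
          (tendsto_pow_atTop_nhds_zero_of_lt_one (by norm_num) (by norm_num))
      have h2 := ENNReal.Tendsto.const_mul (a := ENNReal.ofReal (C * 2 ^ p))
        (tendsto_const_nhds (x := X) |>.add h1) (Or.inr ENNReal.ofReal_ne_top)
      rwa [add_zero] at h2
    have hRlim : Tendsto (fun n => R (φ (ψ n))) atTop (nhds (ENNReal.ofReal (C * 2 ^ p) * X)) :=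
      hR0.comp hφψ
    calc _ = ∫⁻ z in unitDisc, F f₁ f₂ z := (hFint f₁ f₂ hf₁).symm
      _ = ∫⁻ z in unitDisc, liminf (fun n => F (g₁ (φ (ψ n))) (g₂ (φ (ψ n))) z) atTop :=
          setLIntegral_congr_fun measurableSet_unitDisc fun z hz => (hFlim z hz).liminf_eq.symm
      _ ≤ liminf (fun n => ∫⁻ z in unitDisc, F (g₁ (φ (ψ n))) (g₂ (φ (ψ n))) z) atTop :=
          lintegral_liminf_le' fun n =>
            ((hm _ (hg₁ _) p₁).const_mul _).add ((hm _ (hg₂ _) p₂).const_mul _)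
      _ ≤ liminf (fun n => R (φ (ψ n))) atTop :=
          liminf_le_liminf (Eventually.of_forall fun n => by
            rw [hFint _ _ (hg₁ _)]
            exact hbound _)
      _ = _ := hRlim.liminf_eq

theorem stmt13 (p p₁ p₂ : ℝ) (hp : 0 < p) (hp₁ : 0 < p₁) (hp₂ : 0 < p₂)
    (hsum : 1 / p = 1 / p₁ + 1 / p₂) (W : ℂ → ℝ) (hW : IsWeight W)
    (hinv : IsInvariantWeight W) (hdense : PolyDense p W) :
    ∃ C : ℝ, 0 < C ∧ ∀ f : ℂ → ℂ, DifferentiableOn ℂ f unitDisc →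
      IntegrableOn (fun z => ‖f z‖ ^ p * W z) unitDisc →
      ∃ f₁ f₂ : ℂ → ℂ,
        DifferentiableOn ℂ f₁ unitDisc ∧ DifferentiableOn ℂ f₂ unitDisc ∧
        IntegrableOn (fun z => ‖f₁ z‖ ^ p₁ * W z) unitDisc ∧
        IntegrableOn (fun z => ‖f₂ z‖ ^ p₂ * W z) unitDisc ∧
        (∀ z ∈ unitDisc, f z = f₁ z * f₂ z) ∧
        (∫ z in unitDisc, ‖f₁ z‖ ^ p₁ * W z) ^ (p / p₁) *
            (∫ z in unitDisc, ‖f₂ z‖ ^ p₂ * W z) ^ (p / p₂) ≤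
          (p / p₁) * (∫ z in unitDisc, ‖f₁ z‖ ^ p₁ * W z) +
            (p / p₂) * (∫ z in unitDisc, ‖f₂ z‖ ^ p₂ * W z) ∧
        (p / p₁) * (∫ z in unitDisc, ‖f₁ z‖ ^ p₁ * W z) +
            (p / p₂) * (∫ z in unitDisc, ‖f₂ z‖ ^ p₂ * W z) ≤
          C * ∫ z in unitDisc, ‖f z‖ ^ p * W z := by
  have hs₁ : 0 < p / p₁ := by positivity
  have hs₂ : 0 < p / p₂ := by positivity
  have hs : p / p₁ + p / p₂ = 1 := by
    rw [div_eq_mul_one_div p p₁, div_eq_mul_one_div p p₂, ← mul_add, ← hsum,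
      mul_one_div_cancel hp.ne']
  obtain ⟨C, hC, h⟩ := exists_factorization hW hinv hp hdense hp₁ hp₂ hs₁ hs₂ hs
    (div_mul_cancel₀ p hp₁.ne') (div_mul_cancel₀ p hp₂.ne')
  refine ⟨C, hC, fun f hf hfi => ?_⟩
  obtain ⟨f₁, f₂, hf₁, hf₂, hfac, hle⟩ := h f hf hfi
  have hX := lintegral_lt_top_of_integrableOn hfi
  have hRtop := ENNReal.mul_lt_top (ENNReal.ofReal_lt_top (r := C)) hX
  have hT₁ := (le_self_add.trans hle).trans_lt hRtop
  have hT₂ := (le_add_self.trans hle).trans_lt hRtop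
  have hI₁ := ENNReal.lt_top_of_mul_ne_top_right hT₁.ne (ENNReal.ofReal_pos.mpr hs₁).ne'
  have hI₂ := ENNReal.lt_top_of_mul_ne_top_right hT₂.ne (ENNReal.ofReal_pos.mpr hs₂).ne'
  refine ⟨f₁, f₂, hf₁, hf₂, integrableOn_of_lintegral_lt_top hW hf₁ hI₁,
    integrableOn_of_lintegral_lt_top hW hf₂ hI₂, hfac, ?_, ?_⟩
  · rw [integral_eq_toReal_lintegral hW hf₁, integral_eq_toReal_lintegral hW hf₂]
    exact Real.geom_mean_le_arith_mean2_weighted hs₁.le hs₂.le ENNReal.toReal_nonneg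
      ENNReal.toReal_nonneg hs
  · rw [integral_eq_toReal_lintegral hW hf₁, integral_eq_toReal_lintegral hW hf₂,
      integral_eq_toReal_lintegral hW hf]
    have hle' := ENNReal.toReal_mono hRtop.ne hle
    rwa [ENNReal.toReal_add hT₁.ne hT₂.ne, ENNReal.toReal_mul, ENNReal.toReal_mul,
      ENNReal.toReal_mul, ENNReal.toReal_ofReal hs₁.le, ENNReal.toReal_ofReal hs₂.le,
      ENNReal.toReal_ofReal hC.le] at hle'
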